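/- Let U ⊂ ℝ^d be open and let g = (g_1,...,g_s) : U → ℝ^s be a continuous good map such that for every x ∈ U the germs of 1, g_1, ..., g_s at x are linearly independent over ℝ (i.e. no nontrivial linear combination c_0 + c_1 g_1 + ... + c_s g_s vanishes identically on a neighborhood of x). Fix P ∈ M_{s+1,n+1}(ℝ) whose first column is such that the row vector (1, g_1(x),...,g_s(x)) P has first coordinate 1 for all x ∈ U, and define f : U → ℝ^n by (1, f(x)) = (1, g_1(x),...,g_s(x)) P. Then the following are equivalent: (i) condition (3.6) holds for P; (ii) the set {x ∈ U : f(x) is not VWA} is nonempty; (iii) f is extremal. -/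

import Mathlib

open MeasureTheory

/-- `y ∈ W_v(1,n)`: infinitely many `q ∈ ℤ^n` with `|y·q + p| ≤ ‖q‖^{-v}` for some `p ∈ ℤ`. -/
def InW {n : ℕ} (y : Fin n → ℝ) (v : ℝ) : Prop :=
  {q : Fin n → ℤ | ∃ p : ℤ,
    |(∑ i, y i * (q i : ℝ)) + (p : ℝ)| ≤
      ‖(fun i => (q i : ℝ) : Fin n → ℝ)‖ ^ (-v)}.Infinite

/-- `y` is very well approximable. -/
def IsVWA {n : ℕ} (y : Fin n → ℝ) : Prop :=
  ∃ v : ℝ, (n : ℝ) < v ∧ InW y v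

/-- `f` is extremal on `U`: `f x` is not VWA for a.e. `x ∈ U`. -/
def IsExtremal {α : Type*} [MeasureSpace α] {n : ℕ} (U : Set α) (f : α → Fin n → ℝ) : Prop :=
  volume {x ∈ U | IsVWA (f x)} = 0

/-- The `I`-th coordinate (in the basis `e_I`) of `v₁ ∧ … ∧ v_j`, i.e. the `j×j` minor
determinant of the matrix with rows `v₁,…,v_j` and columns indexed by `I`. -/
noncomputable def minorDet {k j : ℕ} (v : Fin j → Fin k → ℤ) (I : Finset (Fin k)) : ℤ :=
  if h : I.card = j then
    Matrix.det (Matrix.of fun a b : Fin j => v a ((I.orderIsoOfFin h) b : Fin k))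
  else 0

/-- `w` (given by its coordinates in the basis `(e_I)_{|I|=j}` of `Λ^j(ℝ^k)`) belongs to
`S_{k,j}`: it represents a rank-`j` subgroup of `ℤ^k`, i.e. `w = v₁ ∧ … ∧ v_j` for some
`ℤ`-basis `v₁,…,v_j` of such a subgroup (equivalently, a `ℤ`-linearly independent family). -/
def IsPrim {k : ℕ} (j : ℕ) (w : Finset (Fin k) → ℝ) : Prop :=
  ∃ v : Fin j → (Fin k → ℤ), LinearIndependent ℤ v ∧
    ∀ I : Finset (Fin k), w I = (minorDet v I : ℝ)

/-- `l(I,i)`: the number of elements of `I` strictly between `0` and `i`. -/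
def lIi {k : ℕ} (I : Finset (Fin (k + 1))) (i : Fin (k + 1)) : ℕ :=
  (I.filter fun a => 0 < a ∧ a < i).card

/-- For `I ∋ 0`, the vector `c_{I,w} = w_I e₀ + ∑_{i ∉ I} (-1)^{l(I,i)} w_{I∪{i}∖{0}} eᵢ`. -/
noncomputable def cIw {k : ℕ} (w : Finset (Fin (k + 1)) → ℝ) (I : Finset (Fin (k + 1))) :
    Fin (k + 1) → ℝ := fun i =>
  if i = 0 then w I
  else if i ∈ I then 0
  else (-1 : ℝ) ^ (lIi I i) * w ((insert i I).erase 0)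

/-- `max_{I ∋ 0, |I| = j} ‖P c_{I,w}‖` (sup norm on `ℝ^{s+1}`). -/
noncomputable def maxNormP {s n : ℕ} (P : Matrix (Fin (s + 1)) (Fin (n + 1)) ℝ) (j : ℕ)
    (w : Finset (Fin (n + 1)) → ℝ) : ℝ :=
  ⨆ I : {I : Finset (Fin (n + 1)) // 0 ∈ I ∧ I.card = j}, ‖P.mulVec (cIw w I.1)‖

/-- `max_{I ∌ 0, |I| = j} |w_I|`. -/
noncomputable def maxCoeff {n : ℕ} (j : ℕ) (w : Finset (Fin (n + 1)) → ℝ) : ℝ :=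
  ⨆ I : {I : Finset (Fin (n + 1)) // 0 ∉ I ∧ I.card = j}, |w I.1|

/-- Condition (3.6) for a matrix `P ∈ M_{s+1,n+1}(ℝ)`: for every `β > 0` there is `T > 0`
such that for all `t ≥ T`, `j = 1,…,n` and `w ∈ S_{n+1,j}`,
`max(e^{((n+1-j)/n)t} max_{I∋0} ‖P c_{I,w}‖, e^{-(j/n)t} max_{I∌0} |w_I|) ≥ e^{-βt}`. -/
def Cond36 {s n : ℕ} (P : Matrix (Fin (s + 1)) (Fin (n + 1)) ℝ) : Prop :=
  ∀ β : ℝ, 0 < β → ∃ T : ℝ, 0 < T ∧ ∀ t : ℝ, T ≤ t → ∀ j : ℕ, 1 ≤ j → j ≤ n →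
    ∀ w : Finset (Fin (n + 1)) → ℝ, IsPrim j w →
      Real.exp (-β * t) ≤
        max (Real.exp ((((n : ℝ) + 1 - (j : ℝ)) / (n : ℝ)) * t) * maxNormP P j w)
            (Real.exp (-((j : ℝ) / (n : ℝ)) * t) * maxCoeff j w)

/-- `g` is `(C,α)`-good on `V`: for every open ball `B ⊆ V` and every `ε > 0`,
`|{x ∈ B : |g x| < ε sup_B |g|}| ≤ C ε^α |B|`. -/
def IsGoodOn {d : ℕ} (C α : ℝ) (g : (Fin d → ℝ) → ℝ) (V : Set (Fin d → ℝ)) : Prop :=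
  ∀ (z : Fin d → ℝ) (ρ : ℝ), 0 < ρ → Metric.ball z ρ ⊆ V → ∀ ε : ℝ, 0 < ε →
    volume {x ∈ Metric.ball z ρ |
        |g x| < ε * sSup ((fun y => |g y|) '' Metric.ball z ρ)} ≤
      ENNReal.ofReal (C * ε ^ α) * volume (Metric.ball z ρ)

/-- `f = (f_1,…,f_n)` is good at `x₀ ∈ U`: there are a neighborhood `V ⊆ U` of `x₀` and
`C, α > 0` such that every linear combination `c₀ + c₁f₁ + … + c_nf_n` is `(C,α)`-good
on `V`. -/
def GoodAt {d n : ℕ} (U : Set (Fin d → ℝ)) (f : (Fin d → ℝ) → Fin n → ℝ)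
    (x₀ : Fin d → ℝ) : Prop :=
  ∃ V ∈ nhds x₀, V ⊆ U ∧ ∃ C : ℝ, 0 < C ∧ ∃ α : ℝ, 0 < α ∧
    ∀ (c₀ : ℝ) (c : Fin n → ℝ),
      IsGoodOn C α (fun x => c₀ + ∑ i, c i * f x i) V

/-- A point `x` is `(ε, ρ)`-marked relative to `Q` if there is a finite flag `F ⊆ Q` whose members
have `ψ`-value in `[ε, ρ)` at `x`, while every other member of `Q` comparable with all of `F` has
`ψ`-value at least `ρ`. -/
def IsMarked {S X : Type*} [PartialOrder S] (ψ : S → X → ℝ) (ε ρ : ℝ) (Q : Set S) (x : X) : Prop :=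
  ∃ F : Set S, F ⊆ Q ∧ F.Finite ∧ IsChain (· ≤ ·) F ∧ (∀ a ∈ F, ε ≤ ψ a x ∧ ψ a x < ρ) ∧
    ∀ a ∈ Q, a ∉ F → (∀ b ∈ F, a ≤ b ∨ b ≤ a) → ρ ≤ ψ a x

theorem IsMarked.of_comparable {S X : Type*} [PartialOrder S] {ψ : S → X → ℝ} {ε ρ : ℝ}
    {Q : Set S} {x : X} {rk : S → ℕ} (hrk : ∀ a b, a ≤ b → rk a = rk b → a = b) {s : S}
    (hs : s ∈ Q) (h : IsMarked ψ ε ρ {a ∈ Q | (a ≤ s ∨ s ≤ a) ∧ rk a ≠ rk s} x)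
    (h1 : ε ≤ ψ s x) (h2 : ψ s x < ρ) : IsMarked ψ ε ρ Q x := by
  obtain ⟨F, hFQ, hFf, hFc, hF, hF'⟩ := h
  refine ⟨insert s F, ?_, hFf.insert s, ?_, ?_, ?_⟩
  · rintro a (rfl | ha)
    · exact hs
    · exact (hFQ ha).1
  · exact hFc.insert fun b hb _ => (hFQ hb).2.1.symm
  · rintro a (rfl | ha)
    · exact ⟨h1, h2⟩
    · exact hF a ha
  · intro a ha haF hcomp
    have has : a ≠ s := fun h => haF (by simp [h])
    have hc := hcomp s (by simp)
    refine hF' a ⟨ha, hc, ?_⟩ (fun h => haF (by simp [h])) fun b hb => hcomp b (by simp [hb])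
    rcases hc with hc | hc
    · exact fun h => has (hrk _ _ hc h)
    · exact fun h => has (hrk _ _ hc h.symm).symm

theorem volume_ball_mul {d : ℕ} (x y : Fin d → ℝ) {r c : ℝ} (hr : 0 < r) (hc : 0 < c) :
    volume (Metric.ball x (c * r)) = ENNReal.ofReal (c ^ d) * volume (Metric.ball y r) := by
  rw [Real.volume_pi_ball _ (by positivity), Real.volume_pi_ball _ hr,
    ← ENNReal.ofReal_mul (by positivity), Fintype.card_fin, ← mul_pow]
  congr 2
  ring

/-- A multiplicative constant for quantitative nondivergence of flags with `l` possible ranks. -/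
noncomputable def flagConst (d : ℕ) : ℕ → ENNReal
  | 0 => 0
  | l + 1 => ENNReal.ofReal (16 ^ d) * (flagConst d l + ENNReal.ofReal (2 ^ d))

theorem flagConst_ne_top (d l : ℕ) : flagConst d l ≠ ⊤ := by
  induction l with
  | zero => simp [flagConst]
  | succ l ih => exact ENNReal.mul_ne_top ENNReal.ofReal_ne_top (by simp [ih])

/-- A set covered by balls of controlled radius has measure controlled by local bounds. -/
theorem measure_le_of_local_bound {d : ℕ} {E Bad : Set (Fin d → ℝ)} {x₀ : Fin d → ℝ} {r₀ : ℝ}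
    (hr₀ : 0 < r₀) (hE : E ⊆ Metric.ball x₀ r₀) (r : (Fin d → ℝ) → ℝ)
    (hr : ∀ x ∈ E, 0 < r x) (hr' : ∀ x ∈ E, r x ≤ 3 * r₀) (hBad : Bad ⊆ E) (K : ENNReal)
    (hK : ∀ x ∈ E, volume (Metric.ball x (r x) ∩ Bad) ≤ K * volume (Metric.ball x (r x))) :
    volume Bad ≤ ENNReal.ofReal (16 ^ d) * K * volume (Metric.ball x₀ r₀) := by
  obtain ⟨u, huE, hud, hu⟩ := Vitali.exists_disjoint_subfamily_covering_enlargement_closedBall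
    E (fun x => x) (fun x => r x / 8) (3 * r₀ / 8) (fun x hx => by
      have := hr' x hx
      linarith) 5 (by norm_num)
  have hpos : ∀ x ∈ u, 0 < r x := fun x hx => hr x (huE hx)
  have hdisj : u.PairwiseDisjoint fun x => Metric.ball x (r x / 8) :=
    hud.mono_on fun x _ => Metric.ball_subset_closedBall
  have hcount : u.Countable := hdisj.countable_of_isOpen (fun _ _ => Metric.isOpen_ball)
    fun x hx => ⟨x, Metric.mem_ball_self (by linarith [hpos x hx])⟩
  have hcover : Bad ⊆ ⋃ x ∈ u, Metric.ball x (r x) ∩ Bad := by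
    intro y hy
    obtain ⟨b, hb, hsub⟩ := hu y (hBad hy)
    have hyb := hsub (Metric.mem_closedBall_self (by linarith [hr y (hBad hy)]))
    rw [Metric.mem_closedBall] at hyb
    refine Set.mem_iUnion₂.2 ⟨b, hb, ?_, hy⟩
    rw [Metric.mem_ball]
    linarith [hpos b hb]
  have hsum : ∑' x : u, volume (Metric.ball (x : Fin d → ℝ) (r x / 8)) ≤
      volume (Metric.ball x₀ (2 * r₀)) := by
    rw [← measure_biUnion hcount hdisj fun _ _ => Metric.isOpen_ball.measurableSet]
    refine measure_mono (Set.iUnion₂_subset fun x hx => ?_)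
    refine Metric.ball_subset_ball' ?_
    have h1 := Metric.mem_ball.1 (hE (huE hx))
    have h2 := hr' x (huE hx)
    linarith
  calc volume Bad ≤ volume (⋃ x ∈ u, Metric.ball x (r x) ∩ Bad) := measure_mono hcover
    _ ≤ ∑' x : u, volume (Metric.ball (x : Fin d → ℝ) (r x) ∩ Bad) :=
        measure_biUnion_le volume hcount _
    _ ≤ ∑' x : u, (K * ENNReal.ofReal (8 ^ d)) *
          volume (Metric.ball (x : Fin d → ℝ) (r x / 8)) := by
        refine ENNReal.tsum_le_tsum fun x => (hK x (huE x.2)).trans_eq ?_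
        rw [mul_assoc, ← volume_ball_mul (x : Fin d → ℝ) _ (by linarith [hpos x x.2]) (by norm_num)]
        congr 3
        ring
    _ ≤ (K * ENNReal.ofReal (8 ^ d)) * volume (Metric.ball x₀ (2 * r₀)) := by
        rw [ENNReal.tsum_mul_left]
        gcongr
    _ = ENNReal.ofReal (16 ^ d) * K * volume (Metric.ball x₀ r₀) := by
        rw [volume_ball_mul x₀ x₀ hr₀ (by norm_num), ← mul_assoc, mul_assoc K,
          ← ENNReal.ofReal_mul (by positivity), ← mul_pow, mul_comm K]
        norm_num

/-- Quantitative nondivergence for flags: if every `ψ s` is good on `V` and reaches the value `ρ`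
near the ball, most points of the ball are marked. -/
theorem volume_not_isMarked_le {d : ℕ} {S : Type*} [PartialOrder S] (rk : S → ℕ)
    (hrk : ∀ a b, a ≤ b → rk a = rk b → a = b) (ψ : S → (Fin d → ℝ) → ℝ) (V : Set (Fin d → ℝ))
    (ε ρ : ℝ) (δ : ENNReal) (l : ℕ) :
    ∀ (R : Finset ℕ), R.card = l → ∀ (Q : Set S), (∀ s ∈ Q, rk s ∈ R) →
    (∀ s ∈ Q, ∀ x ∈ V, ψ s x < ρ → ∀ᶠ y in nhds x, ψ s y < ρ) →
    (∀ s ∈ Q, ∀ z r, 0 < r → Metric.ball z r ⊆ V → (∃ y ∈ Metric.ball z r, ρ ≤ ψ s y) →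
      volume {x ∈ Metric.ball z r | ψ s x < ε} ≤ δ * volume (Metric.ball z r)) →
    ∀ (x₀ : Fin d → ℝ) (r₀ : ℝ), 0 < r₀ → Metric.ball x₀ (8 ^ l * r₀) ⊆ V →
    (∀ s ∈ Q, ∃ y ∈ Metric.ball x₀ (2 * r₀), ρ ≤ ψ s y) →
    volume {x ∈ Metric.ball x₀ r₀ | ¬ IsMarked ψ ε ρ Q x} ≤
      flagConst d l * δ * volume (Metric.ball x₀ r₀) := by
  induction l with
  | zero =>
    intro R hR Q hQ _ _ x₀ r₀ hr₀ _ _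
    have hR' := Finset.card_eq_zero.1 hR
    subst hR'
    have : {x ∈ Metric.ball x₀ r₀ | ¬ IsMarked ψ ε ρ Q x} = ∅ := by
      ext x
      simp only [Set.mem_ofPred_eq, Set.mem_empty_iff_false, iff_false, not_and, not_not]
      intro _
      exact ⟨∅, by simp, by simp, by simp, by simp, fun a ha => absurd (hQ a ha) (by simp)⟩
    rw [this, measure_empty]
    exact zero_le
  | succ l ih =>
    intro R hR Q hQ hcont hgood x₀ r₀ hr₀ hV hsup
    have h8 : (1 : ℝ) ≤ 8 ^ l := one_le_pow₀ (by norm_num)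
    have hBV : Metric.ball x₀ r₀ ⊆ V := (Metric.ball_subset_ball (by
      rw [pow_succ]; nlinarith)).trans hV
    set E := {x ∈ Metric.ball x₀ r₀ | ∃ s ∈ Q, ψ s x < ρ} with hEdef
    have key : ∀ x ∈ E, ∃ r : ℝ, 0 < r ∧ r ≤ 3 * r₀ ∧
        (∃ s ∈ Q, ∀ y ∈ Metric.ball x r, ψ s y < ρ) ∧
        ∀ s ∈ Q, ∃ y ∈ Metric.ball x (2 * r), ρ ≤ ψ s y := by
      rintro x ⟨hx, s, hs, hsx⟩
      set T := {r : ℝ | 0 < r ∧ ∃ s ∈ Q, ∀ y ∈ Metric.ball x r, ψ s y < ρ} with hT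
      have hTne : T.Nonempty := by
        obtain ⟨r, hr, hr'⟩ := Metric.eventually_nhds_iff_ball.1 (hcont s hs x (hBV hx) hsx)
        exact ⟨r, hr, s, hs, hr'⟩
      have hTb : ∀ r ∈ T, r ≤ 3 * r₀ := by
        rintro r ⟨_, s, hs, h⟩
        obtain ⟨y, hy, hy'⟩ := hsup s hs
        by_contra! hlt
        refine absurd (h y ?_) (not_lt.2 hy')
        have h1 := Metric.mem_ball.1 hy
        have h2 := Metric.mem_ball'.1 hx
        rw [Metric.mem_ball]
        linarith [dist_triangle y x₀ x]
      obtain ⟨r1, hr1⟩ := hTne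
      have hsSup : 0 < sSup T := lt_of_lt_of_le hr1.1 (le_csSup ⟨_, hTb⟩ hr1)
      obtain ⟨r, hrT, hr⟩ := exists_lt_of_lt_csSup ⟨r1, hr1⟩ (half_lt_self hsSup)
      refine ⟨r, hrT.1, hTb r hrT, hrT.2, ?_⟩
      intro s hs
      by_contra! hcon
      have : 2 * r ∈ T := ⟨by linarith [hrT.1], s, hs, hcon⟩
      linarith [le_csSup ⟨_, hTb⟩ this]
    choose! r hr0 hr3 hlow hupp using key
    have hbad := measure_le_of_local_bound (E := E)
      (Bad := {x ∈ Metric.ball x₀ r₀ | ¬ IsMarked ψ ε ρ Q x}) hr₀ (fun x hx => hx.1) r hr0 hr3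
      (by
        rintro x ⟨hx, hx'⟩
        refine ⟨hx, ?_⟩
        by_contra! hcon
        exact hx' ⟨∅, by simp, by simp, by simp, by simp, fun a ha _ _ => hcon a ha⟩)
      ((flagConst d l + ENNReal.ofReal (2 ^ d)) * δ)
      (by
        intro x hx
        obtain ⟨σ, hσQ, hσ⟩ := hlow x hx
        have hd : dist x x₀ < r₀ := Metric.mem_ball.1 hx.1
        have hrx := hr0 x hx
        have hrx3 := hr3 x hx
        have hsub : Metric.ball x (r x) ∩ {x ∈ Metric.ball x₀ r₀ | ¬ IsMarked ψ ε ρ Q x} ⊆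
            {y ∈ Metric.ball x (r x) | ¬ IsMarked ψ ε ρ
              {a ∈ Q | (a ≤ σ ∨ σ ≤ a) ∧ rk a ≠ rk σ} y} ∪
            {y ∈ Metric.ball x (2 * r x) | ψ σ y < ε} := by
          rintro y ⟨hy, -, hy'⟩
          by_cases h : ψ σ y < ε
          · exact Or.inr ⟨Metric.ball_subset_ball (by linarith) hy, h⟩
          · refine Or.inl ⟨hy, fun hm => hy' ?_⟩
            exact hm.of_comparable hrk hσQ (not_lt.1 h) (hσ y hy)
        refine (measure_mono hsub).trans ((measure_union_le _ _).trans ?_)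
        rw [add_mul, add_mul]
        refine add_le_add ?_ ?_
        · refine ih (R.erase (rk σ)) ?_ _ ?_ ?_ ?_ x (r x) hrx ?_ ?_
          · rw [Finset.card_erase_of_mem (hQ _ hσQ), hR]; rfl
          · exact fun s hs => Finset.mem_erase.2 ⟨hs.2.2, hQ s hs.1⟩
          · exact fun s hs => hcont s hs.1
          · exact fun s hs => hgood s hs.1
          · refine (Metric.ball_subset_ball' ?_).trans hV
            rw [pow_succ]
            nlinarith
          · exact fun s hs => hupp x hx s hs.1
        · refine (hgood σ hσQ x (2 * r x) (by linarith) ?_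
            (hupp x hx _ hσQ)).trans_eq ?_
          · refine (Metric.ball_subset_ball' ?_).trans hV
            rw [pow_succ]
            nlinarith
          · rw [volume_ball_mul x x hrx (by norm_num)]
            ring)
    refine hbad.trans_eq ?_
    rw [flagConst]
    ring

open scoped Matrix

/-- The largest absolute value of a maximal minor of `A`. -/
noncomputable def maxMinor {j k : ℕ} (A : Matrix (Fin j) (Fin k) ℝ) : ℝ :=
  ‖fun e : Fin j → Fin k => (A.submatrix id e).det‖

theorem maxMinor_nonneg {j k : ℕ} (A : Matrix (Fin j) (Fin k) ℝ) : 0 ≤ maxMinor A :=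
  norm_nonneg _

theorem abs_det_submatrix_le_maxMinor {j k : ℕ} (A : Matrix (Fin j) (Fin k) ℝ)
    (e : Fin j → Fin k) : |(A.submatrix id e).det| ≤ maxMinor A :=
  norm_le_pi_norm (fun e : Fin j → Fin k => (A.submatrix id e).det) e

theorem maxMinor_mul_left {j k : ℕ} (B : Matrix (Fin j) (Fin j) ℝ) (A : Matrix (Fin j) (Fin k) ℝ) :
    maxMinor (B * A) = |B.det| * maxMinor A := by
  have : (fun e : Fin j → Fin k => ((B * A).submatrix id e).det) =
      B.det • fun e : Fin j → Fin k => (A.submatrix id e).det := by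
    ext e
    rw [Pi.smul_apply, smul_eq_mul, ← Matrix.det_mul]
    rfl
  rw [maxMinor, this, norm_smul, Real.norm_eq_abs, maxMinor]

theorem maxMinor_le_mul_of_tail {j k : ℕ} (A : Matrix (Fin (j + 1)) (Fin k) ℝ) :
    maxMinor A ≤ (j + 1) * ‖A 0‖ * maxMinor (A.submatrix Fin.succ id) := by
  have h0 := maxMinor_nonneg (A.submatrix Fin.succ id)
  refine (pi_norm_le_iff_of_nonneg (by positivity)).2 fun e => ?_
  rw [Matrix.det_succ_row_zero, Real.norm_eq_abs]
  refine (Finset.abs_sum_le_sum_abs _ _).trans ?_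
  have : ∀ i ∈ (Finset.univ : Finset (Fin (j + 1))),
      |(-1 : ℝ) ^ (i : ℕ) * A.submatrix id e 0 i *
        ((A.submatrix id e).submatrix Fin.succ i.succAbove).det| ≤
      ‖A 0‖ * maxMinor (A.submatrix Fin.succ id) := by
    intro i _
    rw [abs_mul, abs_mul, abs_pow, abs_neg, abs_one, one_pow, one_mul]
    refine mul_le_mul (norm_le_pi_norm (A 0) (e i)) ?_ (abs_nonneg _) (norm_nonneg _)
    exact abs_det_submatrix_le_maxMinor (A.submatrix Fin.succ id) (e ∘ i.succAbove)
  refine (Finset.sum_le_card_nsmul _ _ _ this).trans_eq ?_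
  simp
  ring

/-- A matrix over a field with linearly independent rows has a nonzero maximal minor. -/
theorem exists_det_submatrix_ne_zero {K : Type*} [Field K] {j k : ℕ}
    (A : Matrix (Fin j) (Fin k) K) (hA : LinearIndependent K A.row) :
    ∃ e : Fin j → Fin k, (A.submatrix id e).det ≠ 0 := by
  have hspan : Submodule.span K (Set.range A.col) = ⊤ := by
    apply Submodule.eq_top_of_finrank_eq
    rw [← Matrix.rank_eq_finrank_span_cols, hA.rank_matrix]
    simp
  obtain ⟨κ, a, ha, hsp, hli⟩ := exists_linearIndependent' K A.col
  let b := Module.Basis.mk hli (by rw [hsp, hspan])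
  have : Finite κ := Finite.of_injective a ha
  have := Fintype.ofFinite κ
  have hcard : Fintype.card κ = j := by
    rw [← Module.finrank_eq_card_basis b]; simp
  let σ : Fin j ≃ κ := (Fintype.equivFinOfCardEq hcard).symm
  refine ⟨a ∘ σ, ?_⟩
  have h2 : LinearIndependent K (A.submatrix id (a ∘ σ)).col := hli.comp σ σ.injective
  rw [Matrix.linearIndependent_cols_iff_isUnit, Matrix.isUnit_iff_isUnit_det] at h2
  exact h2.ne_zero

/-- An integer matrix with linearly independent rows has a nonzero maximal minor. -/
theorem exists_int_det_submatrix_ne_zero {j k : ℕ} (v : Fin j → Fin k → ℤ)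
    (hv : LinearIndependent ℤ v) :
    ∃ e : Fin j → Fin k, ((Matrix.of v).submatrix id e).det ≠ 0 := by
  have h1 : LinearIndependent ℤ (((Matrix.of v).map (Int.cast : ℤ → ℚ)).row) := by
    have := hv.map_injOn ((Int.castAddHom ℚ).toIntLinearMap.compLeft (Fin k))
      (Function.Injective.injOn fun x y h => by
        ext i
        exact Int.cast_injective (α := ℚ) (congrFun h i))
    exact this
  rw [LinearIndependent.iff_fractionRing ℤ ℚ] at h1
  obtain ⟨e, he⟩ := exists_det_submatrix_ne_zero _ h1
  refine ⟨e, fun h => he ?_⟩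
  have : ((Matrix.of v).map (Int.cast : ℤ → ℚ)).submatrix id e =
    ((Matrix.of v).submatrix id e).map (Int.castRingHom ℚ) := rfl
  rw [this, ← RingHom.mapMatrix_apply, ← RingHom.map_det, h, map_zero]

theorem linearIndependent_row_of_det_submatrix_ne_zero {K : Type*} [Field K] {j k : ℕ}
    (A : Matrix (Fin j) (Fin k) K) (e : Fin j → Fin k) (he : (A.submatrix id e).det ≠ 0) :
    LinearIndependent K A.row := by
  have h : LinearIndependent K (A.submatrix id e).row := by
    rw [Matrix.linearIndependent_rows_iff_isUnit, Matrix.isUnit_iff_isUnit_det]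
    exact he.isUnit
  exact LinearIndependent.of_comp (LinearMap.funLeft K K e) h

theorem linearIndependent_row_mul {K : Type*} [Field K] {j k : ℕ}
    (A : Matrix (Fin j) (Fin k) K) (L : Matrix (Fin k) (Fin k) K) (hL : L.det ≠ 0)
    (hA : LinearIndependent K A.row) : LinearIndependent K (A * L).row := by
  have hL' : IsUnit L := (Matrix.isUnit_iff_isUnit_det L).2 hL.isUnit
  have := hA.map_injOn L.vecMulLinear (Matrix.vecMul_injective_iff_isUnit.2 hL').injOn
  exact this

theorem maxMinor_pos {j k : ℕ} (A : Matrix (Fin j) (Fin k) ℝ) (hA : LinearIndependent ℝ A.row) :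
    0 < maxMinor A := by
  obtain ⟨e, he⟩ := exists_det_submatrix_ne_zero A hA
  exact (abs_pos.2 he).trans_le (abs_det_submatrix_le_maxMinor A e)

theorem linearIndependent_intCast_iff {j k : ℕ} (v : Fin j → Fin k → ℤ) :
    LinearIndependent ℝ ((Matrix.of v).map (Int.cast : ℤ → ℝ)).row ↔ LinearIndependent ℤ v := by
  constructor
  · intro h
    have h1 : LinearIndependent ℤ ((Matrix.of v).map (Int.cast : ℤ → ℝ)).row :=
      h.restrict_scalars (by
        intro x y hxy
        simpa using hxy)
    exact LinearIndependent.of_comp ((Int.castAddHom ℝ).toIntLinearMap.compLeft (Fin k)) h1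
  · intro h
    obtain ⟨e, he⟩ := exists_int_det_submatrix_ne_zero v h
    refine linearIndependent_row_of_det_submatrix_ne_zero _ e ?_
    have : ((Matrix.of v).map (Int.cast : ℤ → ℝ)).submatrix id e =
      ((Matrix.of v).submatrix id e).map (Int.castRingHom ℝ) := rfl
    rw [this, ← RingHom.mapMatrix_apply, ← RingHom.map_det]
    simpa using he

/-- Minkowski's linear forms theorem for square matrices. -/
theorem exists_int_vecMul_lt {j : ℕ} (M : Matrix (Fin j) (Fin j) ℝ)
    (hM : M.det ≠ 0) {c : ℝ} (hc : 0 < c) (h : |M.det| < c ^ j) :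
    ∃ z : Fin j → ℤ, z ≠ 0 ∧ ‖(fun a => (z a : ℝ)) ᵥ* M‖ < c := by
  have hli : LinearIndependent ℝ M.row := by
    rw [Matrix.linearIndependent_rows_iff_isUnit, Matrix.isUnit_iff_isUnit_det]
    exact hM.isUnit
  let b := basisOfLinearIndependentOfCardEqFinrank' M.row hli (by simp)
  have hb : (b : Fin j → Fin j → ℝ) = M.row := coe_basisOfLinearIndependentOfCardEqFinrank' _ _ _
  have : Countable (Submodule.span ℤ (Set.range b)).toAddSubgroup :=
    inferInstanceAs (Countable (Submodule.span ℤ (Set.range b)))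
  obtain ⟨⟨x, hxL⟩, hx0, hx⟩ := exists_ne_zero_mem_lattice_of_measure_mul_two_pow_lt_measure
    (ZSpan.isAddFundamentalDomain' b volume) (s := Metric.ball (0 : Fin j → ℝ) c)
    (by simp) (convex_ball _ _) (by
      rw [ZSpan.volume_fundamentalDomain, hb, Real.volume_pi_ball _ hc, mul_pow, mul_comm,
        ENNReal.ofReal_mul (by positivity), ENNReal.ofReal_pow (by norm_num)]
      simp only [Fintype.card_fin, Module.finrank_fin_fun, ENNReal.ofReal_ofNat]
      refine ENNReal.mul_lt_mul_right (by simp) (by simp) ?_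
      exact (ENNReal.ofReal_lt_ofReal_iff (by positivity)).2 h)
  obtain ⟨z, hz⟩ := (Submodule.mem_span_range_iff_exists_fun ℤ).1 hxL
  have hz' : (fun a => (z a : ℝ)) ᵥ* M = x := by
    rw [← hz, hb, Matrix.vecMul_eq_sum]
    refine Finset.sum_congr rfl fun i _ => ?_
    ext b
    simp [Matrix.row]
  refine ⟨z, ?_, ?_⟩
  · rintro rfl
    apply hx0
    ext1
    simp [← hz]
  · rw [hz']
    simpa using hx

/-- Minkowski's theorem for a lattice spanned by the rows of a rectangular matrix, whose covolume
is measured by the largest maximal minor. -/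
theorem exists_int_vecMul_le_of_maxMinor_lt {j k : ℕ} (A : Matrix (Fin j) (Fin k) ℝ)
    (hA : LinearIndependent ℝ A.row) {c : ℝ} (hc : 0 < c) (h : maxMinor A < c ^ j) :
    ∃ z : Fin j → ℤ, z ≠ 0 ∧ ‖(fun a => (z a : ℝ)) ᵥ* A‖ ≤ j * c := by
  obtain ⟨e₀, he₀⟩ := exists_det_submatrix_ne_zero A hA
  have : Nonempty (Fin j → Fin k) := ⟨e₀⟩
  obtain ⟨e, he⟩ := Finite.exists_max fun e : Fin j → Fin k => |(A.submatrix id e).det|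
  set M := A.submatrix id e with hMdef
  have hM : M.det ≠ 0 := abs_pos.1 ((abs_pos.2 he₀).trans_le (he e₀))
  obtain ⟨z, hz0, hz⟩ := exists_int_vecMul_lt M hM hc
    ((abs_det_submatrix_le_maxMinor A e).trans_lt h)
  refine ⟨z, hz0, (pi_norm_le_iff_of_nonneg (by positivity)).2 fun b => ?_⟩
  have hcol : M *ᵥ (M⁻¹ *ᵥ A.col b) = A.col b := by
    rw [Matrix.mulVec_mulVec, Matrix.mul_nonsing_inv _ hM.isUnit, Matrix.one_mulVec]
  have hC : ∀ a, |(M⁻¹ *ᵥ A.col b) a| ≤ 1 := by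
    intro a
    have h1 : M.det * (M⁻¹ *ᵥ A.col b) a = (M.updateCol a (A.col b)).det := by
      rw [← Matrix.cramer_apply, ← Matrix.det_smul_inv_mulVec_eq_cramer _ _ hM.isUnit]
      rfl
    have h2 : M.updateCol a (A.col b) = A.submatrix id (Function.update e a b) := by
      ext i l
      by_cases hl : l = a
      · subst hl; simp
      · simp [hl, hMdef]
    have h3 := he (Function.update e a b)
    rw [← h2, ← h1, abs_mul] at h3
    exact le_of_mul_le_mul_left (by simpa using h3) (abs_pos.2 hM)
  have heq : ((fun a => (z a : ℝ)) ᵥ* A) b =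
      ((fun a => (z a : ℝ)) ᵥ* M) ⬝ᵥ (M⁻¹ *ᵥ A.col b) := by
    rw [← Matrix.dotProduct_mulVec, hcol]
    rfl
  rw [heq, Real.norm_eq_abs]
  refine (Finset.abs_sum_le_sum_abs _ _).trans ?_
  have : ∀ a ∈ (Finset.univ : Finset (Fin j)),
      |((fun a => (z a : ℝ)) ᵥ* M) a * (M⁻¹ *ᵥ A.col b) a| ≤ c := by
    intro a _
    rw [abs_mul]
    have h1 := (norm_le_pi_norm ((fun a => (z a : ℝ)) ᵥ* M) a).trans hz.le
    rw [Real.norm_eq_abs] at h1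
    nlinarith [hC a, abs_nonneg ((M⁻¹ *ᵥ A.col b) a),
      abs_nonneg (((fun a => (z a : ℝ)) ᵥ* M) a)]
  simpa using Finset.sum_le_card_nsmul _ _ _ this

theorem maxMinor_le_of_orderEmb {j k : ℕ} (A : Matrix (Fin j) (Fin k) ℝ) {c : ℝ} (hc : 0 ≤ c)
    (h : ∀ (I : Finset (Fin k)) (hI : I.card = j),
      |(A.submatrix id (I.orderEmbOfFin hI)).det| ≤ c) : maxMinor A ≤ c := by
  refine (pi_norm_le_iff_of_nonneg hc).2 fun e => ?_
  rw [Real.norm_eq_abs]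
  by_cases he : Function.Injective e
  · have hI : (Finset.univ.image e).card = j := by
      rw [Finset.card_image_of_injective _ he]; simp
    have hmem : ∀ b, e b ∈ Finset.univ.image e := fun b => by simp
    let σ : Fin j → Fin j := fun b =>
      ((Finset.univ.image e).orderIsoOfFin hI).symm ⟨e b, hmem b⟩
    have hσ : Function.Injective σ := fun a b hab => by
      simpa [σ, he.eq_iff] using hab
    let τ := Equiv.ofBijective σ (Finite.injective_iff_bijective.1 hσ)
    have : A.submatrix id e =
        (A.submatrix id ((Finset.univ.image e).orderEmbOfFin hI)).submatrix id τ := by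
      ext a b
      simp only [Matrix.submatrix_apply, id, τ, Equiv.ofBijective_apply, σ,
        ← Finset.coe_orderIsoOfFin_apply, OrderIso.apply_symm_apply]
    rw [this, Matrix.det_permute', abs_mul]
    refine le_trans (le_of_eq ?_) (h _ hI)
    rcases Int.units_eq_one_or (Equiv.Perm.sign τ) with h | h <;> simp [h]
  · simp only [Function.Injective, not_forall] at he
    obtain ⟨a, b, hab, hne⟩ := he
    rw [Matrix.det_zero_of_column_eq hne (fun i => by simp [hab])]
    simpa using hc

/-- The matrix `u_Y a_t`: right multiplication by it expands the pairing with `Y` by `exp t` and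
contracts the remaining coordinates by `exp (t / n)`. -/
noncomputable def flowMatrix (n : ℕ) (t : ℝ) (Y : Fin (n + 1) → ℝ) :
    Matrix (Fin (n + 1)) (Fin (n + 1)) ℝ :=
  Matrix.of fun a b =>
    if b = 0 then Real.exp t * Y a else if a = b then Real.exp (-(t / n)) else 0

theorem mul_flowMatrix_apply {j n : ℕ} (A : Matrix (Fin j) (Fin (n + 1)) ℝ) (t : ℝ)
    (Y : Fin (n + 1) → ℝ) (i : Fin j) (b : Fin (n + 1)) :
    (A * flowMatrix n t Y) i b =
      if b = 0 then Real.exp t * (A *ᵥ Y) i else Real.exp (-(t / n)) * A i b := by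
  rw [Matrix.mul_apply]
  split_ifs with h
  · simp [flowMatrix, h, Matrix.mulVec, dotProduct, Finset.mul_sum, mul_left_comm]
  · simp [flowMatrix, h, mul_comm]

theorem vecMul_flowMatrix_apply {n : ℕ} (u : Fin (n + 1) → ℝ) (t : ℝ)
    (Y : Fin (n + 1) → ℝ) (b : Fin (n + 1)) :
    (u ᵥ* flowMatrix n t Y) b =
      if b = 0 then Real.exp t * (u ⬝ᵥ Y) else Real.exp (-(t / n)) * u b := by
  rw [Matrix.vecMul, dotProduct]
  split_ifs with h
  · simp [flowMatrix, h, dotProduct, Finset.mul_sum, mul_left_comm]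
  · simp [flowMatrix, h, mul_comm]

theorem det_flowMatrix {n : ℕ} (hn : n ≠ 0) (t : ℝ) (Y : Fin (n + 1) → ℝ) (hY : Y 0 = 1) :
    (flowMatrix n t Y).det = 1 := by
  rw [Matrix.det_of_isLowerTriangular]
  · rw [Fin.prod_univ_succ]
    simp only [flowMatrix, Matrix.of_apply, if_true, hY, mul_one, Fin.succ_ne_zero, if_false,
      Finset.prod_const, Finset.card_univ, Fintype.card_fin]
    rw [← Real.exp_nat_mul, ← Real.exp_add, Real.exp_eq_one_iff]
    field_simp
    ring
  · intro a b hab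
    have hab' : a < b := hab
    have : b ≠ 0 := (lt_of_le_of_lt (Fin.zero_le a) hab').ne'
    simp [flowMatrix, this, hab'.ne]

theorem det_mul_flowMatrix_of_notMem {j n : ℕ} (A : Matrix (Fin j) (Fin (n + 1)) ℝ) (t : ℝ)
    (Y : Fin (n + 1) → ℝ) (I : Finset (Fin (n + 1))) (hI : I.card = j) (h0 : 0 ∉ I) :
    ((A * flowMatrix n t Y).submatrix id (I.orderEmbOfFin hI)).det =
      Real.exp (-((j : ℝ) / n) * t) * (A.submatrix id (I.orderEmbOfFin hI)).det := by
  have : (A * flowMatrix n t Y).submatrix id (I.orderEmbOfFin hI) =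
      Real.exp (-(t / n)) • A.submatrix id (I.orderEmbOfFin hI) := by
    ext a b
    have hb : I.orderEmbOfFin hI b ≠ 0 := fun h => h0 (h ▸ I.orderEmbOfFin_mem hI b)
    simp [mul_flowMatrix_apply, hb]
  rw [this, Matrix.det_smul, ← Real.exp_nat_mul, Fintype.card_fin]
  congr 2
  ring

theorem orderEmbOfFin_zero_eq {m k : ℕ} (I : Finset (Fin (k + 1))) (hI : I.card = m + 1)
    (h0 : 0 ∈ I) : I.orderEmbOfFin hI 0 = 0 := by
  refine le_antisymm ?_ (Fin.zero_le _)
  obtain ⟨c, hc⟩ : (0 : Fin (k + 1)) ∈ Set.range (I.orderEmbOfFin hI) := by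
    rw [I.range_orderEmbOfFin hI]; exact h0
  rw [← hc]
  exact (I.orderEmbOfFin hI).monotone (Fin.zero_le c)

theorem det_updateCol_col_of_mem {m k : ℕ} (A : Matrix (Fin (m + 1)) (Fin (k + 1)) ℝ)
    (I : Finset (Fin (k + 1))) (hI : I.card = m + 1) (h0 : 0 ∈ I) {a : Fin (k + 1)} (ha : a ∈ I)
    (ha0 : a ≠ 0) :
    ((A.submatrix id (I.orderEmbOfFin hI)).updateCol 0 (A.col a)).det = 0 := by
  obtain ⟨b, hb⟩ : ∃ b, I.orderEmbOfFin hI b = a := by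
    have := I.range_orderEmbOfFin hI
    exact (this ▸ Finset.mem_coe.2 ha : a ∈ Set.range (I.orderEmbOfFin hI))
  have he0 := orderEmbOfFin_zero_eq I hI h0
  have hb0 : b ≠ 0 := fun h => ha0 (by rw [← hb, h, he0])
  refine Matrix.det_zero_of_column_eq (i := 0) (j := b) hb0.symm fun i => ?_
  simp [hb0, hb]

theorem card_filter_lt_orderEmbOfFin {α : Type*} [LinearOrder α] (s : Finset α) {m : ℕ}
    (h : s.card = m) (p : Fin m) : (s.filter (· < s.orderEmbOfFin h p)).card = p := by
  have : s.filter (· < s.orderEmbOfFin h p) =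
      (Finset.univ.filter (· < p)).map (s.orderEmbOfFin h).toEmbedding := by
    ext x
    simp only [Finset.mem_filter, Finset.mem_map, Finset.mem_univ, true_and]
    constructor
    · rintro ⟨hx, hlt⟩
      obtain ⟨b, rfl⟩ : x ∈ Set.range (s.orderEmbOfFin h) := by
        rw [s.range_orderEmbOfFin h]; exact hx
      exact ⟨b, by simpa using hlt, rfl⟩
    · rintro ⟨b, hb, rfl⟩
      exact ⟨s.orderEmbOfFin_mem h b, by simpa using hb⟩
  rw [this, Finset.card_map]
  have : Finset.univ.filter (· < p) = Finset.Iio p := by ext; simp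
  rw [this, Fin.card_Iio]

theorem det_updateCol_col_of_notMem {m k : ℕ} (A : Matrix (Fin (m + 1)) (Fin (k + 1)) ℝ)
    (I : Finset (Fin (k + 1))) (hI : I.card = m + 1) (h0 : 0 ∈ I) {a : Fin (k + 1)} (ha : a ∉ I)
    {I' : Finset (Fin (k + 1))} (hI'def : I' = (insert a I).erase 0) (hI' : I'.card = m + 1) :
    ((A.submatrix id (I.orderEmbOfFin hI)).updateCol 0 (A.col a)).det =
      (-1 : ℝ) ^ lIi I a *
        (A.submatrix id (I'.orderEmbOfFin hI')).det := by
  have ha0 : a ≠ 0 := fun h => ha (h ▸ h0)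
  have haI' : a ∈ I' := by simp [hI'def, ha0]
  obtain ⟨p, hp⟩ : a ∈ Set.range (I'.orderEmbOfFin hI') := by
    rw [I'.range_orderEmbOfFin hI']; exact haI'
  have hE : (I.erase 0).card = m := by rw [Finset.card_erase_of_mem h0, hI]; rfl
  have he0 := orderEmbOfFin_zero_eq I hI h0
  have hs1 : (fun i : Fin m => I.orderEmbOfFin hI i.succ) = (I.erase 0).orderEmbOfFin hE := by
    refine Finset.orderEmbOfFin_unique hE (fun i => ?_) fun i j hij => ?_
    · refine Finset.mem_erase.2 ⟨fun h => ?_, I.orderEmbOfFin_mem hI _⟩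
      have := (I.orderEmbOfFin hI).injective (h.trans he0.symm)
      exact Fin.succ_ne_zero _ this
    · simpa using hij
  have hs2 : (fun i : Fin m => I'.orderEmbOfFin hI' (p.succAbove i)) =
      (I.erase 0).orderEmbOfFin hE := by
    refine Finset.orderEmbOfFin_unique hE (fun i => ?_) fun i j hij => ?_
    · have h1 := I'.orderEmbOfFin_mem hI' (p.succAbove i)
      have h2 : I'.orderEmbOfFin hI' (p.succAbove i) ≠ a := fun h =>
        Fin.succAbove_ne p i ((I'.orderEmbOfFin hI').injective (h.trans hp.symm))
      simp only [hI'def, Finset.mem_erase, Finset.mem_insert] at h1 h2 ⊢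
      tauto
    · simpa using hij
  have hl : lIi I a = p := by
    rw [← card_filter_lt_orderEmbOfFin I' hI' p, hp, lIi]
    congr 1
    ext x
    simp only [hI'def, Finset.mem_filter, Finset.mem_erase, Finset.mem_insert]
    constructor
    · rintro ⟨h1, h2, h3⟩
      exact ⟨⟨h2.ne', Or.inr h1⟩, h3⟩
    · rintro ⟨⟨h1, h2⟩, h3⟩
      exact ⟨h2.resolve_left h3.ne, Fin.pos_of_ne_zero h1, h3⟩
  rw [Matrix.det_succ_column_zero, Matrix.det_succ_column _ p, Finset.mul_sum]
  refine Finset.sum_congr rfl fun i _ => ?_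
  have hM : ((A.submatrix id (I.orderEmbOfFin hI)).updateCol 0 (A.col a)).submatrix
      i.succAbove Fin.succ =
      (A.submatrix id (I'.orderEmbOfFin hI')).submatrix i.succAbove p.succAbove := by
    refine Matrix.ext fun x y => ?_
    have : I.orderEmbOfFin hI y.succ = I'.orderEmbOfFin hI' (p.succAbove y) :=
      congrFun (hs1.trans hs2.symm) y
    rw [Matrix.submatrix_apply, Matrix.submatrix_apply, Matrix.submatrix_apply,
      Matrix.updateCol_ne (Fin.succ_ne_zero _), Matrix.submatrix_apply, this]
  rw [hM, hl, pow_add]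
  have : ((-1 : ℝ) ^ (p : ℕ)) * (-1) ^ (p : ℕ) = 1 := by rw [← mul_pow]; simp
  simp only [Matrix.updateCol_self, Matrix.col_apply, Matrix.submatrix_apply, id, hp]
  linear_combination (-((-1 : ℝ) ^ (i : ℕ) * A i a *
    ((A.submatrix id (I'.orderEmbOfFin hI')).submatrix i.succAbove p.succAbove).det)) * this

theorem det_updateCol_mulVec {m k : ℕ} (A : Matrix (Fin (m + 1)) (Fin (k + 1)) ℝ)
    (w : Finset (Fin (k + 1)) → ℝ)
    (hw : ∀ I (hI : I.card = m + 1), w I = (A.submatrix id (I.orderEmbOfFin hI)).det)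
    (I : Finset (Fin (k + 1))) (hI : I.card = m + 1) (h0 : 0 ∈ I) (Y : Fin (k + 1) → ℝ) :
    ((A.submatrix id (I.orderEmbOfFin hI)).updateCol 0 (A *ᵥ Y)).det = Y ⬝ᵥ cIw w I := by
  have hY : A *ᵥ Y = ∑ a, Y a • A.col a := by
    ext i
    simp [Matrix.mulVec, dotProduct, mul_comm]
  rw [← Matrix.cramer_apply, hY, map_sum, Finset.sum_apply, dotProduct]
  refine Finset.sum_congr rfl fun a _ => ?_
  rw [map_smul, Pi.smul_apply, smul_eq_mul, Matrix.cramer_apply, cIw]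
  congr 1
  split_ifs with h1 h2
  · rw [hw I hI]
    congr 1
    ext x y
    by_cases hy : y = 0
    · subst hy; simp [orderEmbOfFin_zero_eq I hI h0, h1]
    · simp [hy]
  · exact det_updateCol_col_of_mem A I hI h0 h2 h1
  · have hI' : ((insert a I).erase 0).card = m + 1 := by
      rw [Finset.card_erase_of_mem (by simp [h0]), Finset.card_insert_of_notMem h2, hI]; rfl
    rw [hw _ hI', det_updateCol_col_of_notMem A I hI h0 h2 rfl hI']

theorem det_mul_flowMatrix_of_mem {j n : ℕ} (hn : n ≠ 0) (A : Matrix (Fin j) (Fin (n + 1)) ℝ)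
    (t : ℝ) (Y : Fin (n + 1) → ℝ) (w : Finset (Fin (n + 1)) → ℝ)
    (hw : ∀ I (hI : I.card = j), w I = (A.submatrix id (I.orderEmbOfFin hI)).det)
    (I : Finset (Fin (n + 1))) (hI : I.card = j) (h0 : 0 ∈ I) :
    ((A * flowMatrix n t Y).submatrix id (I.orderEmbOfFin hI)).det =
      Real.exp (((n : ℝ) + 1 - j) / n * t) * (Y ⬝ᵥ cIw w I) := by
  obtain ⟨m, rfl⟩ : ∃ m, j = m + 1 :=
    Nat.exists_eq_succ_of_ne_zero (by rw [← hI]; exact Finset.card_ne_zero_of_mem h0)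
  have he0 := orderEmbOfFin_zero_eq I hI h0
  have : (A * flowMatrix n t Y).submatrix id (I.orderEmbOfFin hI) =
      Matrix.of fun x y => (Fin.cons (Real.exp t) fun _ => Real.exp (-(t / n)) :
        Fin (m + 1) → ℝ) y *
          ((A.submatrix id (I.orderEmbOfFin hI)).updateCol 0 (A *ᵥ Y)) x y := by
    ext x y
    simp only [Matrix.submatrix_apply, id, mul_flowMatrix_apply, Matrix.of_apply]
    refine Fin.cases ?_ (fun y => ?_) y
    · simp [he0]
    · have : I.orderEmbOfFin hI y.succ ≠ 0 := fun h =>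
        Fin.succ_ne_zero _ ((I.orderEmbOfFin hI).injective (h.trans he0.symm))
      simp [this]
  rw [this, Matrix.det_mul_row, det_updateCol_mulVec A w hw I hI h0, Fin.prod_univ_succ]
  simp only [Fin.cons_zero, Fin.cons_succ, Finset.prod_const, Finset.card_univ, Fintype.card_fin]
  rw [← Real.exp_nat_mul, ← Real.exp_add]
  congr 2
  push_cast
  field_simp
  ring

/-- The real matrix whose rows are given integer vectors. -/
def intRows {j k : ℕ} (v : Fin j → Fin k → ℤ) : Matrix (Fin j) (Fin k) ℝ :=
  (Matrix.of v).map Int.cast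

theorem minorDet_eq_det {j k : ℕ} (v : Fin j → Fin k → ℤ) (I : Finset (Fin k))
    (hI : I.card = j) :
    (minorDet v I : ℝ) = ((intRows v).submatrix id (I.orderEmbOfFin hI)).det := by
  rw [minorDet, dif_pos hI, ← eq_intCast (Int.castRingHom ℝ), RingHom.map_det]
  rfl

theorem exists_norm_gt_of_infinite {n : ℕ} {S : Set (Fin n → ℤ)} (hS : S.Infinite) (R : ℝ) :
    ∃ q ∈ S, R < ‖(fun i => (q i : ℝ) : Fin n → ℝ)‖ := by
  by_contra! h
  refine hS ((Set.finite_Icc (fun _ => -⌈R⌉ : Fin n → ℤ) (fun _ => ⌈R⌉)).subset fun q hq => ?_)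
  have hi : ∀ i, |q i| ≤ ⌈R⌉ := fun i => by
    have h1 := (norm_le_pi_norm (fun i => (q i : ℝ) : Fin n → ℝ) i).trans (h q hq)
    rw [Real.norm_eq_abs] at h1
    exact_mod_cast h1.trans (Int.le_ceil R)
  exact ⟨fun i => (abs_le.1 (hi i)).1, fun i => (abs_le.1 (hi i)).2⟩

theorem dotProduct_cons_one {n : ℕ} (u : Fin (n + 1) → ℝ) (y : Fin n → ℝ) :
    u ⬝ᵥ (Fin.cons 1 y : Fin (n + 1) → ℝ) = (∑ i, y i * u i.succ) + u 0 := by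
  rw [dotProduct, Fin.sum_univ_succ]
  simp only [Fin.cons_zero, Fin.cons_succ, mul_one]
  rw [add_comm]
  simp only [mul_comm]

/-- Dani correspondence: a very well approximable vector yields integer vectors that become
exponentially short along the flow, at integer times. -/
theorem IsVWA.exists_exponentially_short {n : ℕ} (hn : n ≠ 0) {y : Fin n → ℝ} (hy : IsVWA y) :
    ∃ γ : ℝ, 0 < γ ∧ ∀ N : ℕ, ∃ t : ℕ, N ≤ t ∧ ∃ u : Fin (n + 1) → ℤ, u ≠ 0 ∧
      ‖(fun a => (u a : ℝ)) ᵥ* flowMatrix n t (Fin.cons 1 y)‖ ≤ Real.exp (-γ * t) := by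
  obtain ⟨v, hv, hS⟩ := hy
  have hn0 : (0 : ℝ) < n := by positivity
  have hv0 : 0 < v := hn0.trans hv
  have hvn : 1 < v / n := (one_lt_div hn0).2 hv
  set γ : ℝ := (v / n - 1) / (2 * (v + 1)) with hγ
  have hγ0 : 0 < γ := div_pos (by linarith) (by linarith)
  have hγv : γ * (v + 1) = (v / n - 1) / 2 := by rw [hγ]; field_simp
  set κ : ℝ := 1 / n - γ with hκ
  have hκv : κ * v - 1 - γ = (v / n - 1) / 2 := by
    rw [hκ]
    linear_combination (-1 : ℝ) * hγv
  have hκ0 : 0 < κ := by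
    by_contra! h
    nlinarith
  refine ⟨γ, hγ0, fun N => ?_⟩
  set T₀ : ℝ := κ * v / (κ * v - 1 - γ) with hT₀
  obtain ⟨q, ⟨p, hp⟩, hq⟩ := exists_norm_gt_of_infinite hS (Real.exp (κ * max (N : ℝ) T₀))
  set h := ‖(fun i => (q i : ℝ) : Fin n → ℝ)‖ with hh
  have hh0 : 0 < h := (Real.exp_pos _).trans hq
  have hlog : κ * max (N : ℝ) T₀ < Real.log h := (Real.lt_log_iff_exp_lt hh0).2 hq
  set t := ⌈Real.log h / κ⌉₊ with ht
  have ht1 : Real.log h / κ ≤ t := Nat.le_ceil _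
  have hmax : max (N : ℝ) T₀ < Real.log h / κ := by rwa [lt_div_iff₀ hκ0, mul_comm]
  have ht2 : (t : ℝ) < Real.log h / κ + 1 :=
    Nat.ceil_lt_add_one (((Nat.cast_nonneg N).trans (le_max_left _ _)).trans hmax.le)
  rw [div_le_iff₀ hκ0] at ht1
  have ht2' : κ * (t - 1) < Real.log h := by
    have : (t : ℝ) - 1 < Real.log h / κ := by linarith
    rwa [lt_div_iff₀ hκ0, mul_comm] at this
  have hNt : (N : ℝ) ≤ t := (le_max_left _ T₀).trans (hmax.le.trans (Nat.le_ceil _))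
  have hTt : T₀ ≤ t := (le_max_right (N : ℝ) _).trans (hmax.le.trans (Nat.le_ceil _))
  refine ⟨t, by exact_mod_cast hNt, Fin.cons p q, fun h0 => ?_, ?_⟩
  · have hq0 : q = 0 := by
      ext i
      simpa using congrFun h0 i.succ
    rw [hh, hq0] at hh0
    simp [← Pi.zero_def] at hh0
  · refine (pi_norm_le_iff_of_nonneg (Real.exp_pos _).le).2 fun b => ?_
    rw [vecMul_flowMatrix_apply, Real.norm_eq_abs]
    split_ifs with hb
    · rw [dotProduct_cons_one, abs_mul, abs_of_pos (Real.exp_pos _)]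
      simp only [Fin.cons_zero, Fin.cons_succ]
      refine (mul_le_mul_of_nonneg_left hp (Real.exp_pos _).le).trans ?_
      rw [Real.rpow_def_of_pos hh0, ← Real.exp_add, Real.exp_le_exp]
      have h1 : κ * v ≤ t * (κ * v - 1 - γ) := by
        rwa [hT₀, div_le_iff₀ (by linarith)] at hTt
      nlinarith
    · obtain ⟨i, rfl⟩ := Fin.exists_succ_eq.2 hb
      rw [abs_mul, abs_of_pos (Real.exp_pos _), Fin.cons_succ]
      have h1 : |(q i : ℝ)| ≤ h := norm_le_pi_norm (fun i => (q i : ℝ) : Fin n → ℝ) i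
      refine (mul_le_mul_of_nonneg_left h1 (Real.exp_pos _).le).trans ?_
      rw [← Real.exp_log hh0, ← Real.exp_add, Real.exp_le_exp]
      rw [hκ] at ht1
      have : (t : ℝ) * (1 / n - γ) = t / n - γ * t := by ring
      linarith

/-- Dani correspondence: integer vectors that become exponentially short along the flow force very
good approximations. -/
theorem isVWA_of_exponentially_short {n : ℕ} (hn : n ≠ 0) {y : Fin n → ℝ} {γ : ℝ} (hγ : 0 < γ)
    (h : ∀ T : ℝ, ∃ t : ℝ, T ≤ t ∧ ∃ u : Fin (n + 1) → ℤ, u ≠ 0 ∧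
      ‖(fun a => (u a : ℝ)) ᵥ* flowMatrix n t (Fin.cons 1 y)‖ ≤ Real.exp (-γ * t)) :
    IsVWA y := by
  have hn0 : (0 : ℝ) < n := by positivity
  refine ⟨n * (1 + γ), by nlinarith, ?_⟩
  set v : ℝ := n * (1 + γ) with hv
  set S := {q : Fin n → ℤ | ∃ p : ℤ, |(∑ i, y i * (q i : ℝ)) + (p : ℝ)| ≤
      ‖(fun i => (q i : ℝ) : Fin n → ℝ)‖ ^ (-v)} with hS
  change S.Infinite
  have key : ∀ T : ℝ, ∃ t : ℝ, T ≤ t ∧ ∃ q ∈ S, q ≠ 0 ∧ ∃ p : ℤ,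
      |(∑ i, y i * (q i : ℝ)) + (p : ℝ)| ≤ Real.exp (-(1 + γ) * t) := by
    intro T
    obtain ⟨t, ht, u, hu, hle⟩ := h (max T 1)
    have ht0 : 0 < t := one_pos.trans_le ((le_max_right _ _).trans ht)
    have hb := (pi_norm_le_iff_of_nonneg (Real.exp_pos _).le).1 hle
    have h0 : |(∑ i, y i * (u i.succ : ℝ)) + (u 0 : ℝ)| ≤ Real.exp (-(1 + γ) * t) := by
      have := hb 0
      rw [vecMul_flowMatrix_apply, if_pos rfl, dotProduct_cons_one, Real.norm_eq_abs, abs_mul,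
        abs_of_pos (Real.exp_pos _)] at this
      rw [show -(1 + γ) * t = -t + -γ * t by ring, Real.exp_add, Real.exp_neg,
        inv_mul_eq_div, le_div_iff₀ (Real.exp_pos _)]
      linarith
    have hq : ∀ i : Fin n, |(u i.succ : ℝ)| ≤ Real.exp ((1 / n - γ) * t) := by
      intro i
      have := hb i.succ
      rw [vecMul_flowMatrix_apply, if_neg (Fin.succ_ne_zero _), Real.norm_eq_abs, abs_mul,
        abs_of_pos (Real.exp_pos _)] at this
      rw [show (1 / n - γ) * t = t / n + -γ * t by ring, Real.exp_add]
      rw [Real.exp_neg, inv_mul_eq_div, div_le_iff₀ (Real.exp_pos _)] at this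
      linarith
    have hq0 : (fun i : Fin n => u i.succ) ≠ 0 := by
      intro h00
      have hz : ∀ i : Fin n, u i.succ = 0 := fun i => congrFun h00 i
      simp only [hz, Int.cast_zero, mul_zero, Finset.sum_const_zero, zero_add] at h0
      have : |(u 0 : ℝ)| < 1 := h0.trans_lt (Real.exp_lt_one_iff.2 (by nlinarith))
      have hu0 : u 0 = 0 := Int.abs_lt_one_iff.1 (by exact_mod_cast this)
      exact hu (funext fun a => Fin.cases hu0 hz a)
    have hnorm : ‖(fun i => (u i.succ : ℝ) : Fin n → ℝ)‖ ≤ Real.exp ((1 / n - γ) * t) :=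
      (pi_norm_le_iff_of_nonneg (Real.exp_pos _).le).2 hq
    have hpos : 0 < ‖(fun i => (u i.succ : ℝ) : Fin n → ℝ)‖ := by
      refine norm_pos_iff.2 fun h00 => hq0 (funext fun i => ?_)
      exact Int.cast_eq_zero.1 (congrFun h00 i)
    refine ⟨t, (le_max_left _ _).trans ht, fun i => u i.succ, ⟨u 0, h0.trans ?_⟩, hq0, u 0, h0⟩
    refine le_trans ?_ (Real.rpow_le_rpow_of_nonpos hpos hnorm (by rw [hv]; nlinarith))
    rw [← Real.exp_mul, Real.exp_le_exp]
    have : (1 / n - γ) * t * -v = -(1 + γ) * t + n * γ * (1 + γ) * t := by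
      rw [hv]; field_simp; ring
    rw [this]
    have : 0 ≤ n * γ * (1 + γ) * t := by positivity
    linarith
  by_cases hex : ∃ q : Fin n → ℤ, q ≠ 0 ∧ ∃ p : ℤ, (∑ i, y i * (q i : ℝ)) + (p : ℝ) = 0
  · obtain ⟨q, hq, p, hp⟩ := hex
    refine Set.infinite_of_injective_forall_mem (f := fun k : ℕ => k • q)
      (fun a b hab => ?_) fun k => ⟨k * p, ?_⟩
    · obtain ⟨i, hi⟩ := Function.ne_iff.1 hq
      have := congrFun hab i
      simp only [Pi.smul_apply, nsmul_eq_mul] at this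
      exact_mod_cast mul_right_cancel₀ hi this
    · have : (∑ i, y i * (((k • q) i : ℤ) : ℝ)) + ((k * p : ℤ) : ℝ) = 0 := by
        rw [← mul_zero (k : ℝ), ← hp, mul_add, Finset.mul_sum]
        push_cast
        congr 1
        refine Finset.sum_congr rfl fun i _ => ?_
        simp
        ring
      rw [this, abs_zero]
      positivity
  · intro hfin
    push Not at hex
    have hev : ∀ q ∈ S, ∀ᶠ t : ℝ in Filter.atTop, q ≠ 0 → ∀ p : ℤ,
        Real.exp (-(1 + γ) * t) < |(∑ i, y i * (q i : ℝ)) + (p : ℝ)| := by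
      intro q _
      by_cases hq : q = 0
      · simp [hq]
      set x := ∑ i, y i * (q i : ℝ)
      have hpos : 0 < |x - round x| := by
        refine abs_pos.2 fun h0 => hex q hq (-round x) ?_
        push_cast
        linarith
      have hlim : Filter.Tendsto (fun t : ℝ => Real.exp (-(1 + γ) * t)) Filter.atTop (nhds 0) :=
        Real.tendsto_exp_atBot.comp
          (Filter.tendsto_id.const_mul_atTop_of_neg (by linarith : -(1 + γ) < 0))
      filter_upwards [hlim.eventually_lt_const hpos] with t ht _ p
      refine ht.trans_le ((round_le x (-p)).trans (le_of_eq ?_))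
      push_cast
      rw [sub_neg_eq_add]
    obtain ⟨T, hT⟩ := Filter.eventually_atTop.1 ((Filter.eventually_all_finite hfin).2 hev)
    obtain ⟨t, ht, q, hqS, hq, p, hp⟩ := key T
    exact absurd hp (not_le.2 (hT t ht q hqS hq p))

theorem abs_dotProduct_le {m : ℕ} (a b : Fin m → ℝ) : |a ⬝ᵥ b| ≤ m * ‖a‖ * ‖b‖ := by
  refine (Finset.abs_sum_le_sum_abs _ _).trans ?_
  have : ∀ i ∈ (Finset.univ : Finset (Fin m)), |a i * b i| ≤ ‖a‖ * ‖b‖ := fun i _ => by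
    rw [abs_mul]
    exact mul_le_mul (norm_le_pi_norm a i) (norm_le_pi_norm b i) (abs_nonneg _) (norm_nonneg _)
  simpa [mul_assoc] using Finset.sum_le_card_nsmul _ _ _ this

theorem norm_mulVec_cIw_le_maxNormP {s n j : ℕ} (P : Matrix (Fin (s + 1)) (Fin (n + 1)) ℝ)
    (w : Finset (Fin (n + 1)) → ℝ) {I : Finset (Fin (n + 1))} (h0 : 0 ∈ I) (hI : I.card = j) :
    ‖P.mulVec (cIw w I)‖ ≤ maxNormP P j w :=
  le_ciSup (f := fun I : {I : Finset (Fin (n + 1)) // 0 ∈ I ∧ I.card = j} =>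
    ‖P.mulVec (cIw w I.1)‖) (Set.finite_range _).bddAbove ⟨I, h0, hI⟩

theorem abs_le_maxCoeff {n j : ℕ} (w : Finset (Fin (n + 1)) → ℝ) {I : Finset (Fin (n + 1))}
    (h0 : 0 ∉ I) (hI : I.card = j) : |w I| ≤ maxCoeff j w :=
  le_ciSup (f := fun I : {I : Finset (Fin (n + 1)) // 0 ∉ I ∧ I.card = j} => |w I.1|)
    (Set.finite_range _).bddAbove ⟨I, h0, hI⟩

theorem dotProduct_eq_of_eq_vecMul {s n : ℕ} {P : Matrix (Fin (s + 1)) (Fin (n + 1)) ℝ}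
    {G : Fin (s + 1) → ℝ} {Y : Fin (n + 1) → ℝ} (hY : Y = G ᵥ* P) (c : Fin (n + 1) → ℝ) :
    Y ⬝ᵥ c = G ⬝ᵥ P *ᵥ c := by
  rw [hY, Matrix.dotProduct_mulVec]

theorem maxMinor_mul_flowMatrix_le {s n j : ℕ} (hn : n ≠ 0)
    {P : Matrix (Fin (s + 1)) (Fin (n + 1)) ℝ} {G : Fin (s + 1) → ℝ} {Y : Fin (n + 1) → ℝ}
    (hY : Y = G ᵥ* P) {w : Finset (Fin (n + 1)) → ℝ} {v : Fin j → Fin (n + 1) → ℤ}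
    (hw : ∀ I, w I = (minorDet v I : ℝ)) (t : ℝ) :
    maxMinor (intRows v * flowMatrix n t Y) ≤
      (1 + (s + 1) * ‖G‖) * max (Real.exp ((((n : ℝ) + 1 - (j : ℝ)) / (n : ℝ)) * t) *
        maxNormP P j w) (Real.exp (-((j : ℝ) / (n : ℝ)) * t) * maxCoeff j w) := by
  set K := 1 + (s + 1) * ‖G‖ with hK
  have hK1 : 1 ≤ K := by
    rw [hK]
    exact le_add_of_nonneg_right (by positivity)
  have hGK : (s + 1) * ‖G‖ ≤ K := by rw [hK]; linarith
  set m := max (Real.exp ((((n : ℝ) + 1 - (j : ℝ)) / (n : ℝ)) * t) *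
        maxNormP P j w) (Real.exp (-((j : ℝ) / (n : ℝ)) * t) * maxCoeff j w) with hm
  have hm0 : 0 ≤ m := le_max_of_le_left
    (mul_nonneg (Real.exp_pos _).le (Real.iSup_nonneg fun _ => norm_nonneg _))
  refine maxMinor_le_of_orderEmb _ (by positivity) fun I hI => ?_
  by_cases h0 : 0 ∈ I
  · rw [det_mul_flowMatrix_of_mem hn (intRows v) t Y w
      (fun I hI => (hw I).trans (minorDet_eq_det v I hI)) I hI h0, abs_mul,
      abs_of_pos (Real.exp_pos _), dotProduct_eq_of_eq_vecMul hY]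
    have h1 := abs_dotProduct_le G (P *ᵥ cIw w I)
    have h2 := norm_mulVec_cIw_le_maxNormP P w h0 hI
    push_cast at h1
    calc _ ≤ Real.exp (((n : ℝ) + 1 - j) / n * t) * (K * maxNormP P j w) :=
          mul_le_mul_of_nonneg_left (h1.trans (mul_le_mul hGK h2 (norm_nonneg _)
            (by linarith))) (Real.exp_pos _).le
      _ = K * (Real.exp (((n : ℝ) + 1 - j) / n * t) * maxNormP P j w) := by ring
      _ ≤ K * m := mul_le_mul_of_nonneg_left (le_max_left _ _) (by linarith)
  · rw [det_mul_flowMatrix_of_notMem _ _ _ I hI h0, abs_mul, abs_of_pos (Real.exp_pos _),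
      ← minorDet_eq_det v I hI, ← hw I]
    calc _ ≤ Real.exp (-((j : ℝ) / n) * t) * maxCoeff j w :=
          mul_le_mul_of_nonneg_left (abs_le_maxCoeff w h0 hI) (Real.exp_pos _).le
      _ ≤ m := le_max_right _ _
      _ ≤ K * m := le_mul_of_one_le_left hm0 hK1

theorem intCast_vecMul {j k : ℕ} (z : Fin j → ℤ) (v : Fin j → Fin k → ℤ) :
    (fun a => ((z ᵥ* Matrix.of v) a : ℝ)) = (fun a => (z a : ℝ)) ᵥ* intRows v := by
  ext a
  simp [Matrix.vecMul, dotProduct, intRows]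

theorem vecMul_of_ne_zero {j k : ℕ} {v : Fin j → Fin k → ℤ} (hv : LinearIndependent ℤ v)
    {z : Fin j → ℤ} (hz : z ≠ 0) : z ᵥ* Matrix.of v ≠ 0 := fun h => hz <| by
  rw [Matrix.vecMul_eq_sum] at h
  exact funext (Fintype.linearIndependent_iff.1 hv z h)

theorem linearIndependent_row_intRows {j k : ℕ} {v : Fin j → Fin k → ℤ}
    (hv : LinearIndependent ℤ v) : LinearIndependent ℝ (intRows v).row :=
  (linearIndependent_intCast_iff v).2 hv

theorem det_flowMatrix_cons_ne_zero {n : ℕ} (hn : n ≠ 0) (t : ℝ) (y : Fin n → ℝ) :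
    (flowMatrix n t (Fin.cons 1 y)).det ≠ 0 := by
  rw [det_flowMatrix hn t _ (Fin.cons_zero (α := fun _ => ℝ) _ _)]
  exact one_ne_zero

theorem linearIndependent_row_mul_flowMatrix {j n : ℕ} (hn : n ≠ 0)
    {v : Fin j → Fin (n + 1) → ℤ} (hv : LinearIndependent ℤ v) (t : ℝ) (y : Fin n → ℝ) :
    LinearIndependent ℝ (intRows v * flowMatrix n t (Fin.cons 1 y)).row :=
  linearIndependent_row_mul _ _ (det_flowMatrix_cons_ne_zero hn t y)
    (linearIndependent_row_intRows hv)

/-- If the quantitative nondegeneracy condition fails for `P`, every point of the row space of `P`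
with leading coordinate `1` is very well approximable. -/
theorem isVWA_of_not_cond36 {s n : ℕ} (hn : n ≠ 0) {P : Matrix (Fin (s + 1)) (Fin (n + 1)) ℝ}
    (hP : ¬ Cond36 P) {G : Fin (s + 1) → ℝ} {y : Fin n → ℝ}
    (hy : (Fin.cons 1 y : Fin (n + 1) → ℝ) = G ᵥ* P) : IsVWA y := by
  simp only [Cond36] at hP
  push Not at hP
  obtain ⟨β, hβ, hP⟩ := hP
  set γ : ℝ := β / (2 * (n + 1)) with hγ
  have hγ0 : 0 < γ := by positivity
  set K := 1 + (s + 1) * ‖G‖ with hK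
  have hK0 : 0 < K := by positivity
  have hlim : Filter.Tendsto (fun t : ℝ => K * ((n : ℝ) + 1) ^ (n + 1) * Real.exp (-(β / 2) * t))
      Filter.atTop (nhds (K * ((n : ℝ) + 1) ^ (n + 1) * 0)) :=
    (Real.tendsto_exp_atBot.comp (Filter.tendsto_id.const_mul_atTop_of_neg
      (by linarith : -(β / 2) < 0))).const_mul _
  rw [mul_zero] at hlim
  obtain ⟨T₁, hT₁⟩ := Filter.eventually_atTop.1 (hlim.eventually_lt_const one_pos)
  refine isVWA_of_exponentially_short hn hγ0 fun T => ?_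
  obtain ⟨t, ht, j, hj1, hjn, w, ⟨v, hv, hw⟩, hlt⟩ :=
    hP (max T (max T₁ 1)) (lt_max_of_lt_right (lt_max_of_lt_right one_pos))
  have hTt : T ≤ t := (le_max_left _ _).trans ht
  have ht1 : T₁ ≤ t := (le_max_left _ _).trans ((le_max_right _ _).trans ht)
  have ht0 : 0 < t := one_pos.trans_le ((le_max_right _ _).trans ((le_max_right _ _).trans ht))
  set c : ℝ := Real.exp (-γ * t) / (n + 1) with hc
  have hc0 : 0 < c := by positivity
  have hexp1 : Real.exp (-γ * t) ≤ 1 := Real.exp_le_one_iff.2 (by nlinarith)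
  have hc1 : c ≤ 1 := by
    rw [hc, div_le_one (by positivity)]
    have : (0 : ℝ) ≤ n := by positivity
    linarith
  have hmm : maxMinor (intRows v * flowMatrix n t (Fin.cons 1 y)) < c ^ j := by
    refine (maxMinor_mul_flowMatrix_le hn hy hw t).trans_lt ?_
    refine (mul_lt_mul_of_pos_left hlt hK0).trans_le ?_
    refine le_trans ?_ (pow_le_pow_of_le_one hc0.le hc1 (by omega : j ≤ n + 1))
    rw [hc, div_pow, ← Real.exp_nat_mul, le_div_iff₀ (by positivity)]
    have e1 : ((n + 1 : ℕ) : ℝ) * (-γ * t) = -(β / 2) * t := by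
      rw [hγ]; push_cast; field_simp
    have e2 : Real.exp (-β * t) = Real.exp (-(β / 2) * t) * Real.exp (-(β / 2) * t) := by
      rw [← Real.exp_add]; congr 1; ring
    rw [e1, e2]
    have := hT₁ t ht1
    have hpos := Real.exp_pos (-(β / 2) * t)
    nlinarith
  have hli := linearIndependent_row_mul_flowMatrix hn hv t y
  obtain ⟨z, hz, hle⟩ := exists_int_vecMul_le_of_maxMinor_lt _ hli hc0 hmm
  refine ⟨t, hTt, z ᵥ* Matrix.of v, vecMul_of_ne_zero hv hz, ?_⟩
  rw [intCast_vecMul, Matrix.vecMul_vecMul]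
  refine hle.trans ?_
  rw [hc, mul_div_assoc', div_le_iff₀ (by positivity), mul_comm]
  refine mul_le_mul_of_nonneg_left ?_ (Real.exp_pos _).le
  have : (j : ℝ) ≤ n := by exact_mod_cast hjn
  linarith

theorem exists_det_submatrix_eq_maxMinor {j k : ℕ} (A : Matrix (Fin j) (Fin (k + 1)) ℝ) :
    ∃ e : Fin j → Fin (k + 1), maxMinor A = |(A.submatrix id e).det| := by
  obtain ⟨e, he⟩ := Finite.exists_max fun e : Fin j → Fin (k + 1) => |(A.submatrix id e).det|
  exact ⟨e, le_antisymm ((pi_norm_le_iff_of_nonneg (abs_nonneg _)).2 he)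
    (abs_det_submatrix_le_maxMinor A e)⟩

theorem exists_nat_eq_maxMinor {j k : ℕ} (v : Fin j → Fin (k + 1) → ℤ) :
    ∃ m : ℕ, maxMinor (intRows v) = m := by
  obtain ⟨e, he⟩ := exists_det_submatrix_eq_maxMinor (intRows v)
  refine ⟨((Matrix.of v).submatrix id e).det.natAbs, ?_⟩
  rw [he, Nat.cast_natAbs, Int.cast_abs, ← eq_intCast (Int.castRingHom ℝ), RingHom.map_det]
  rfl

/-- The real subspace spanned by a family of integer vectors. -/
def intSpan {j k : ℕ} (v : Fin j → Fin k → ℤ) : Submodule ℝ (Fin k → ℝ) :=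
  Submodule.span ℝ (Set.range (intRows v).row)

theorem finrank_intSpan {j k : ℕ} {v : Fin j → Fin k → ℤ} (hv : LinearIndependent ℤ v) :
    Module.finrank ℝ (intSpan v) = j := by
  rw [intSpan, finrank_span_eq_card (linearIndependent_row_intRows hv), Fintype.card_fin]

theorem exists_eq_mul_intRows_of_intSpan_le {j k : ℕ} {v v' : Fin j → Fin k → ℤ}
    (h : intSpan v' ≤ intSpan v) : ∃ B : Matrix (Fin j) (Fin j) ℝ, intRows v' = B * intRows v := by
  have hmem : ∀ i, ∃ c : Fin j → ℝ, ∑ l, c l • (intRows v).row l = (intRows v').row i :=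
    fun i => (Submodule.mem_span_range_iff_exists_fun ℝ).1
      (h (Submodule.subset_span (Set.mem_range_self i)))
  choose B hB using hmem
  refine ⟨Matrix.of B, Matrix.ext fun i a => ?_⟩
  have := congrFun (hB i) a
  simpa [Matrix.mul_apply] using this.symm

/-- Nonzero rational subspaces of `ℝ ^ k`. -/
abbrev RatSubspace (k : ℕ) : Type :=
  {W : Submodule ℝ (Fin k → ℝ) // ∃ j : ℕ, 1 ≤ j ∧ ∃ v : Fin j → Fin k → ℤ,
    LinearIndependent ℤ v ∧ intSpan v = W}

/-- A rational subspace contains an integer family of least covolume. -/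
theorem RatSubspace.exists_minimal {k : ℕ} (W : RatSubspace (k + 1)) :
    ∃ j : ℕ, 1 ≤ j ∧ ∃ v : Fin j → Fin (k + 1) → ℤ, LinearIndependent ℤ v ∧ intSpan v = W.1 ∧
      ∀ (j' : ℕ) (v' : Fin j' → Fin (k + 1) → ℤ), LinearIndependent ℤ v' → intSpan v' = W.1 →
        ∀ L : Matrix (Fin (k + 1)) (Fin (k + 1)) ℝ,
          maxMinor (intRows v * L) ≤ maxMinor (intRows v' * L) := by
  obtain ⟨W, j, hj, v₀, hv₀, hW⟩ := W
  have hex : ∃ m : ℕ, ∃ v : Fin j → Fin (k + 1) → ℤ,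
      (LinearIndependent ℤ v ∧ intSpan v = W) ∧ maxMinor (intRows v) = m := by
    obtain ⟨m, hm⟩ := exists_nat_eq_maxMinor v₀
    exact ⟨m, v₀, ⟨hv₀, hW⟩, hm⟩
  classical
  obtain ⟨v, ⟨hv, hvW⟩, hvm⟩ := Nat.find_spec hex
  refine ⟨j, hj, v, hv, hvW, fun j' v' hv' hvW' L => ?_⟩
  obtain rfl : j' = j := by
    rw [← finrank_intSpan hv', ← finrank_intSpan hv, hvW, hvW']
  obtain ⟨B, hB⟩ := exists_eq_mul_intRows_of_intSpan_le (hvW'.trans hvW.symm).le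
  obtain ⟨m', hm'⟩ := exists_nat_eq_maxMinor v'
  have hle : maxMinor (intRows v) ≤ maxMinor (intRows v') := by
    rw [hvm, hm']
    exact_mod_cast Nat.find_min' hex ⟨v', ⟨hv', hvW'⟩, hm'⟩
  rw [hB, maxMinor_mul_left] at hle
  have hpos := maxMinor_pos _ (linearIndependent_row_intRows hv)
  have hB1 : 1 ≤ |B.det| := by
    by_contra! h
    nlinarith
  rw [hB, Matrix.mul_assoc, maxMinor_mul_left]
  exact le_mul_of_one_le_left (maxMinor_nonneg _) hB1

/-- The covolume of the integer points of a rational subspace after applying `L`. -/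
noncomputable def RatSubspace.covol {k : ℕ} (W : RatSubspace (k + 1))
    (L : Matrix (Fin (k + 1)) (Fin (k + 1)) ℝ) : ℝ :=
  maxMinor (intRows W.exists_minimal.choose_spec.2.choose * L)

theorem RatSubspace.exists_covol_eq {k : ℕ} (W : RatSubspace (k + 1)) :
    ∃ j : ℕ, 1 ≤ j ∧ ∃ v : Fin j → Fin (k + 1) → ℤ, LinearIndependent ℤ v ∧ intSpan v = W.1 ∧
      ∀ L, W.covol L = maxMinor (intRows v * L) :=
  ⟨_, W.exists_minimal.choose_spec.1, _, W.exists_minimal.choose_spec.2.choose_spec.1,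
    W.exists_minimal.choose_spec.2.choose_spec.2.1, fun _ => rfl⟩

theorem RatSubspace.covol_le {k : ℕ} (W : RatSubspace (k + 1)) {j : ℕ}
    {v : Fin j → Fin (k + 1) → ℤ} (hv : LinearIndependent ℤ v) (hW : intSpan v = W.1)
    (L : Matrix (Fin (k + 1)) (Fin (k + 1)) ℝ) : W.covol L ≤ maxMinor (intRows v * L) :=
  W.exists_minimal.choose_spec.2.choose_spec.2.2 _ _ hv hW L

theorem maxMinor_of_isEmpty {k : ℕ} (A : Matrix (Fin 0) (Fin k) ℝ) : maxMinor A = 1 := by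
  simp [maxMinor]

theorem intSpan_cons {j k : ℕ} (u : Fin k → ℤ) (v : Fin j → Fin k → ℤ) :
    intSpan (Fin.cons u v : Fin (j + 1) → Fin k → ℤ) =
      Submodule.span ℝ {(fun a => (u a : ℝ))} ⊔ intSpan v := by
  have : (intRows (Fin.cons u v : Fin (j + 1) → Fin k → ℤ)).row =
      (Fin.cons (fun a => (u a : ℝ)) (intRows v).row : Fin (j + 1) → Fin k → ℝ) := by
    funext i
    refine Fin.cases rfl (fun i => rfl) i
  rw [intSpan, this, Fin.range_cons, Submodule.span_insert, intSpan]

theorem linearIndependent_cons_int {j k : ℕ} {u : Fin k → ℤ} {v : Fin j → Fin k → ℤ}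
    (hv : LinearIndependent ℤ v) (hu : (fun a => (u a : ℝ)) ∉ intSpan v) :
    LinearIndependent ℤ (Fin.cons u v : Fin (j + 1) → Fin k → ℤ) := by
  rw [← linearIndependent_intCast_iff]
  have : ((Matrix.of (Fin.cons u v : Fin (j + 1) → Fin k → ℤ)).map (Int.cast : ℤ → ℝ)).row =
      (Fin.cons (fun a => (u a : ℝ)) (intRows v).row : Fin (j + 1) → Fin k → ℝ) := by
    funext i
    refine Fin.cases rfl (fun i => rfl) i
  rw [this, linearIndependent_finCons]
  exact ⟨linearIndependent_row_intRows hv, hu⟩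

/-- If some flag of rational subspaces has covolumes in `[ε, ρ)` and every other rational subspace
compatible with it has covolume at least `ρ`, then no nonzero integer vector is short. -/
theorem le_norm_vecMul_of_flag {k : ℕ} (L : Matrix (Fin (k + 1)) (Fin (k + 1)) ℝ) {ε ρ : ℝ}
    (hερ : ε ≤ ρ) (hρ : ρ ≤ 1) {F : Set (RatSubspace (k + 1))} (hF : F.Finite)
    (hchain : IsChain (· ≤ ·) F) (h₁ : ∀ a ∈ F, ε ≤ a.covol L ∧ a.covol L < ρ)
    (h₂ : ∀ a ∉ F, (∀ b ∈ F, a ≤ b ∨ b ≤ a) → ρ ≤ a.covol L) {u : Fin (k + 1) → ℤ}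
    (hu : u ≠ 0) : ε ≤ (k + 1) * ‖(fun a => (u a : ℝ)) ᵥ* L‖ := by
  set uR : Fin (k + 1) → ℝ := fun a => (u a : ℝ) with huR
  have huR0 : uR ≠ 0 := fun h => hu (funext fun a => Int.cast_eq_zero.1 (congrFun h a))
  obtain ⟨j, v, hv, hmax, huv, hcomp⟩ : ∃ (j : ℕ) (v : Fin j → Fin (k + 1) → ℤ),
      LinearIndependent ℤ v ∧ maxMinor (intRows v * L) ≤ 1 ∧ uR ∉ intSpan v ∧
        ∀ a ∈ F, a.1 ≤ intSpan v ∨ (intSpan v ≤ a.1 ∧ uR ∈ a.1) := by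
    rcases Set.eq_empty_or_nonempty {a ∈ F | uR ∉ a.1} with hG | hG
    · have hbot : intSpan (Fin.elim0 : Fin 0 → Fin (k + 1) → ℤ) = ⊥ := by
        rw [intSpan, Set.range_eq_empty, Submodule.span_empty]
      refine ⟨0, Fin.elim0, linearIndependent_empty_type, (maxMinor_of_isEmpty _).le, ?_, ?_⟩
      · rwa [hbot, Submodule.mem_bot]
      · intro a ha
        refine Or.inr ⟨hbot ▸ bot_le, ?_⟩
        by_contra h
        exact (Set.eq_empty_iff_forall_notMem.1 hG) a ⟨ha, h⟩
    · obtain ⟨W, ⟨hWF, huW⟩, hWmax⟩ := Set.exists_max_image _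
        (fun a : RatSubspace (k + 1) => Module.finrank ℝ a.1) (hF.subset (Set.sep_subset _ _)) hG
      obtain ⟨j, -, v, hv, hvW, hcov⟩ := W.exists_covol_eq
      refine ⟨j, v, hv, by rw [← hcov]; exact (h₁ W hWF).2.le.trans hρ, hvW ▸ huW, ?_⟩
      intro a ha
      rw [hvW]
      by_cases hua : uR ∈ a.1
      · refine Or.inr ⟨(hchain.total ha hWF).resolve_left fun h => huW (h hua), hua⟩
      · refine Or.inl ?_
        rcases hchain.total ha hWF with h | h
        · exact h
        · exact (Submodule.eq_of_le_of_finrank_le h (hWmax a ⟨ha, hua⟩)).ge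
  have hli := linearIndependent_cons_int hv huv
  set v₁ : Fin (j + 1) → Fin (k + 1) → ℤ := Fin.cons u v with hv₁
  let W₁ : RatSubspace (k + 1) := ⟨intSpan v₁, j + 1, by omega, v₁, hli, rfl⟩
  have hW₁ : W₁.1 = Submodule.span ℝ {uR} ⊔ intSpan v := intSpan_cons u v
  have hcompW : ∀ b ∈ F, W₁ ≤ b ∨ b ≤ W₁ := by
    intro b hb
    rcases hcomp b hb with h | ⟨h, h'⟩
    · refine Or.inr (?_ : b.1 ≤ W₁.1)
      rw [hW₁]
      exact h.trans le_sup_right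
    · refine Or.inl (?_ : W₁.1 ≤ b.1)
      rw [hW₁]
      exact sup_le (by simpa using h') h
  have hε : ε ≤ W₁.covol L := by
    by_cases hWF : W₁ ∈ F
    · exact (h₁ W₁ hWF).1
    · exact hερ.trans (h₂ W₁ hWF hcompW)
  have hjk : j ≤ k := by
    have := (linearIndependent_row_intRows hli).fintype_card_le_finrank
    simpa using this
  refine hε.trans ((W₁.covol_le hli rfl L).trans ((maxMinor_le_mul_of_tail _).trans ?_))
  have e1 : (intRows v₁ * L) 0 = uR ᵥ* L := rfl
  have e2 : (intRows v₁ * L).submatrix Fin.succ id = intRows v * L := rfl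
  rw [e1, e2]
  have hjk' : (j : ℝ) ≤ k := by exact_mod_cast hjk
  have hn := norm_nonneg (uR ᵥ* L)
  calc ((j : ℝ) + 1) * ‖uR ᵥ* L‖ * maxMinor (intRows v * L)
      ≤ ((j : ℝ) + 1) * ‖uR ᵥ* L‖ * 1 := mul_le_mul_of_nonneg_left hmax (by positivity)
    _ ≤ (k + 1) * ‖uR ᵥ* L‖ := by nlinarith

/-- Uniform lower bound for the linear combinations of `1, g₁, …, g_s` on a ball. -/
theorem exists_le_abs_dotProduct {d s : ℕ} {U : Set (Fin d → ℝ)} {g : (Fin d → ℝ) → Fin s → ℝ}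
    (hindep : ∀ x ∈ U, ∀ (c₀ : ℝ) (c : Fin s → ℝ),
      (∀ᶠ y in nhds x, c₀ + ∑ i, c i * g y i = 0) → c₀ = 0 ∧ c = 0)
    {z : Fin d → ℝ} {r : ℝ} (hr : 0 < r) (hz : z ∈ U) :
    ∃ c : ℝ, 0 < c ∧ ∀ a : Fin (s + 1) → ℝ, ∃ y ∈ Metric.ball z r,
      c * ‖a‖ ≤ |(Fin.cons 1 (g y) : Fin (s + 1) → ℝ) ⬝ᵥ a| := by
  have hsphere : ∃ c : ℝ, 0 < c ∧ ∀ a ∈ Metric.sphere (0 : Fin (s + 1) → ℝ) 1,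
      ∃ y ∈ Metric.ball z r, c ≤ |(Fin.cons 1 (g y) : Fin (s + 1) → ℝ) ⬝ᵥ a| := by
    refine IsCompact.induction_on (p := fun S => ∃ c : ℝ, 0 < c ∧ ∀ a ∈ S,
      ∃ y ∈ Metric.ball z r, c ≤ |(Fin.cons 1 (g y) : Fin (s + 1) → ℝ) ⬝ᵥ a|)
      (isCompact_sphere _ _) ⟨1, one_pos, by simp⟩ ?_ ?_ ?_
    · rintro S S' hSS ⟨c, hc, h⟩
      exact ⟨c, hc, fun a ha => h a (hSS ha)⟩
    · rintro S S' ⟨c, hc, h⟩ ⟨c', hc', h'⟩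
      refine ⟨min c c', lt_min hc hc', ?_⟩
      rintro a (ha | ha)
      · obtain ⟨y, hy, hle⟩ := h a ha
        exact ⟨y, hy, (min_le_left _ _).trans hle⟩
      · obtain ⟨y, hy, hle⟩ := h' a ha
        exact ⟨y, hy, (min_le_right _ _).trans hle⟩
    · intro a ha
      have ha0 : a ≠ 0 := by
        rintro rfl
        simp at ha
      obtain ⟨y, hy, hya⟩ : ∃ y ∈ Metric.ball z r,
          (Fin.cons 1 (g y) : Fin (s + 1) → ℝ) ⬝ᵥ a ≠ 0 := by
        by_contra! h
        have := hindep z hz (a 0) (fun i => a i.succ) (by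
          filter_upwards [Metric.ball_mem_nhds z hr] with y hy
          have := h y hy
          rw [dotProduct_comm, dotProduct_cons_one] at this
          rw [add_comm]
          simpa only [mul_comm] using this)
        exact ha0 (funext fun b => Fin.cases this.1 (congrFun this.2) b)
      have hpos := abs_pos.2 hya
      have hcont : Continuous fun b : Fin (s + 1) → ℝ =>
          |(Fin.cons 1 (g y) : Fin (s + 1) → ℝ) ⬝ᵥ b| := by
        unfold dotProduct
        fun_prop
      refine ⟨_, mem_nhdsWithin_of_mem_nhds (hcont.continuousAt.eventually_const_lt
        (half_lt_self hpos)), _, half_pos hpos, fun b hb => ⟨y, hy, le_of_lt hb⟩⟩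
  obtain ⟨c, hc, h⟩ := hsphere
  refine ⟨c, hc, fun a => ?_⟩
  by_cases ha : a = 0
  · exact ⟨z, Metric.mem_ball_self hr, by simp [ha]⟩
  · have hna := norm_pos_iff.2 ha
    obtain ⟨y, hy, hle⟩ := h (‖a‖⁻¹ • a) (by simp [norm_smul, hna.ne'])
    refine ⟨y, hy, ?_⟩
    rw [dotProduct_smul, smul_eq_mul, abs_mul, abs_of_pos (inv_pos.2 hna), inv_mul_eq_div,
      le_div_iff₀ hna] at hle
    exact hle

theorem continuousOn_of_cons_eq_vecMul {d s n : ℕ} {U : Set (Fin d → ℝ)}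
    {g : (Fin d → ℝ) → Fin s → ℝ} (hcont : ContinuousOn g U)
    {P : Matrix (Fin (s + 1)) (Fin (n + 1)) ℝ} {f : (Fin d → ℝ) → Fin n → ℝ}
    (hfP : ∀ x ∈ U, Fin.cons 1 (f x) = Matrix.vecMul (Fin.cons 1 (g x)) P) :
    ContinuousOn f U := by
  have h1 : ContinuousOn (fun x i => (Matrix.vecMul (Fin.cons 1 (g x)) P) (Fin.succ i)) U := by
    refine continuousOn_pi.2 fun i => ?_
    simp only [Matrix.vecMul, dotProduct, Fin.sum_univ_succ, Fin.cons_zero, Fin.cons_succ]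
    have := continuousOn_pi.1 hcont
    fun_prop
  refine h1.congr fun x hx => funext fun i => ?_
  simpa using congrFun (hfP x hx) i.succ

theorem continuous_maxMinor_mul_flowMatrix {j n : ℕ} (A : Matrix (Fin j) (Fin (n + 1)) ℝ)
    (t : ℝ) :
    Continuous fun y : Fin n → ℝ => maxMinor (A * flowMatrix n t (Fin.cons 1 y)) := by
  refine continuous_norm.comp (continuous_pi fun e => Continuous.matrix_det ?_)
  refine continuous_pi fun a => continuous_pi fun b => ?_
  simp only [Matrix.submatrix_apply, mul_flowMatrix_apply, Matrix.mulVec]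
  split_ifs
  · simp only [dotProduct_cons_one]
    fun_prop
  · fun_prop

theorem exists_orderEmb_le_abs_det {j k : ℕ} (A : Matrix (Fin j) (Fin k) ℝ) {ρ : ℝ} (hρ : 0 < ρ)
    (h : ρ ≤ maxMinor A) :
    ∃ (I : Finset (Fin k)) (hI : I.card = j), ρ ≤ |(A.submatrix id (I.orderEmbOfFin hI)).det| := by
  rcases isEmpty_or_nonempty {I : Finset (Fin k) // I.card = j} with hE | hE
  · exact absurd (h.trans (maxMinor_le_of_orderEmb A le_rfl fun I hI => hE.elim ⟨I, hI⟩))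
      (not_le.2 hρ)
  · obtain ⟨⟨I, hI⟩, hmax⟩ := Finite.exists_max fun I : {I : Finset (Fin k) // I.card = j} =>
      |(A.submatrix id (I.1.orderEmbOfFin I.2)).det|
    exact ⟨I, hI, h.trans (maxMinor_le_of_orderEmb A (abs_nonneg _) fun I hI => hmax ⟨I, hI⟩)⟩

/-- Along the family `(1, f) = (1, g) P`, every maximal minor is an affine combination of `g`. -/
theorem exists_det_eq_affine {s n j : ℕ} (hn : n ≠ 0) (P : Matrix (Fin (s + 1)) (Fin (n + 1)) ℝ)
    (v : Fin j → Fin (n + 1) → ℤ) (t : ℝ) (I : Finset (Fin (n + 1))) (hI : I.card = j) :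
    ∃ (c₀ : ℝ) (c : Fin s → ℝ), ∀ (G : Fin s → ℝ) (y : Fin n → ℝ),
      (Fin.cons 1 y : Fin (n + 1) → ℝ) = Matrix.vecMul (Fin.cons 1 G) P →
      ((intRows v * flowMatrix n t (Fin.cons 1 y)).submatrix id (I.orderEmbOfFin hI)).det =
        c₀ + ∑ i, c i * G i := by
  by_cases h0 : 0 ∈ I
  · set b := Real.exp (((n : ℝ) + 1 - j) / n * t) •
      (P *ᵥ cIw (fun I => (minorDet v I : ℝ)) I) with hb
    refine ⟨b 0, fun i => b i.succ, fun G y hy => ?_⟩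
    rw [det_mul_flowMatrix_of_mem hn (intRows v) t _ (fun I => (minorDet v I : ℝ))
      (fun I hI => minorDet_eq_det v I hI) I hI h0, dotProduct_eq_of_eq_vecMul hy,
      ← smul_eq_mul, ← dotProduct_smul, ← hb, dotProduct_comm, dotProduct_cons_one, add_comm]
    simp only [mul_comm]
  · exact ⟨_, 0, fun G y _ => by
      rw [det_mul_flowMatrix_of_notMem _ _ _ I hI h0]; simp; rfl⟩

theorem volume_maxMinor_lt_le {d s n j : ℕ} (hn : n ≠ 0) {g : (Fin d → ℝ) → Fin s → ℝ}
    {P : Matrix (Fin (s + 1)) (Fin (n + 1)) ℝ} {f : (Fin d → ℝ) → Fin n → ℝ}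
    {V : Set (Fin d → ℝ)} {M : ℝ} (hM : ∀ x ∈ V, ∀ i, |g x i| ≤ M)
    (hfP : ∀ x ∈ V, Fin.cons 1 (f x) = Matrix.vecMul (Fin.cons 1 (g x)) P) {C α : ℝ}
    (hgood : ∀ (c₀ : ℝ) (c : Fin s → ℝ), IsGoodOn C α (fun x => c₀ + ∑ i, c i * g x i) V)
    (v : Fin j → Fin (n + 1) → ℤ) (t : ℝ) {ε ρ : ℝ} (hε : 0 < ε) (hρ : 0 < ρ) {z : Fin d → ℝ}
    {r : ℝ} (hr : 0 < r) (hV : Metric.ball z r ⊆ V) (hsup : ∃ y ∈ Metric.ball z r,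
      ρ ≤ maxMinor (intRows v * flowMatrix n t (Fin.cons 1 (f y)))) :
    volume {x ∈ Metric.ball z r |
        maxMinor (intRows v * flowMatrix n t (Fin.cons 1 (f x))) < ε} ≤
      ENNReal.ofReal (C * (ε / ρ) ^ α) * volume (Metric.ball z r) := by
  obtain ⟨y, hy, hρy⟩ := hsup
  obtain ⟨I, hI, hρI⟩ := exists_orderEmb_le_abs_det _ hρ hρy
  obtain ⟨c₀, c, hc⟩ := exists_det_eq_affine hn P v t I hI
  rw [hc _ _ (hfP y (hV hy))] at hρI
  refine (measure_mono ?_).trans (hgood c₀ c z r hr hV (ε / ρ) (div_pos hε hρ))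
  rintro x ⟨hx, hlt⟩
  refine ⟨hx, ?_⟩
  have h1 := (abs_det_submatrix_le_maxMinor (intRows v * flowMatrix n t (Fin.cons 1 (f x)))
    (I.orderEmbOfFin hI)).trans_lt hlt
  rw [hc _ _ (hfP x (hV hx))] at h1
  have hbdd : BddAbove ((fun y => |c₀ + ∑ i, c i * g y i|) '' Metric.ball z r) := by
    refine ⟨|c₀| + ∑ i, |c i| * M, ?_⟩
    rintro _ ⟨y, hy, rfl⟩
    refine (abs_add_le _ _).trans (add_le_add le_rfl ((Finset.abs_sum_le_sum_abs _ _).trans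
      (Finset.sum_le_sum fun i _ => ?_)))
    rw [abs_mul]
    exact mul_le_mul_of_nonneg_left (hM y (hV hy) i) (abs_nonneg _)
  have h2 := hρI.trans (le_csSup hbdd ⟨y, hy, rfl⟩)
  refine h1.trans_le ?_
  rw [div_mul_eq_mul_div, le_div_iff₀ hρ]
  exact mul_le_mul_of_nonneg_left h2 hε.le

/-- On every ball the covolume of each rational family exceeds the bound given by the quantitative
nondegeneracy condition. -/
theorem exists_le_maxMinor_of_cond36 {d s n : ℕ} (hn : n ≠ 0) {U : Set (Fin d → ℝ)}
    {g : (Fin d → ℝ) → Fin s → ℝ}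
    (hindep : ∀ x ∈ U, ∀ (c₀ : ℝ) (c : Fin s → ℝ),
      (∀ᶠ y in nhds x, c₀ + ∑ i, c i * g y i = 0) → c₀ = 0 ∧ c = 0)
    {P : Matrix (Fin (s + 1)) (Fin (n + 1)) ℝ} {f : (Fin d → ℝ) → Fin n → ℝ}
    (hfP : ∀ x ∈ U, Fin.cons 1 (f x) = Matrix.vecMul (Fin.cons 1 (g x)) P)
    (hP : Cond36 P) {z : Fin d → ℝ} {r : ℝ} (hr : 0 < r) (hz : Metric.ball z r ⊆ U) :
    ∃ c : ℝ, 0 < c ∧ c ≤ 1 ∧ ∀ β : ℝ, 0 < β → ∃ T : ℝ, ∀ t : ℝ, T ≤ t → ∀ j : ℕ, 1 ≤ j →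
      ∀ v : Fin j → Fin (n + 1) → ℤ, LinearIndependent ℤ v → ∃ y ∈ Metric.ball z r,
        c * Real.exp (-β * t) ≤ maxMinor (intRows v * flowMatrix n t (Fin.cons 1 (f y))) := by
  obtain ⟨c, hc, hcg⟩ := exists_le_abs_dotProduct hindep hr (hz (Metric.mem_ball_self hr))
  refine ⟨min c 1, lt_min hc one_pos, min_le_right _ _, fun β hβ => ?_⟩
  obtain ⟨T, hT0, hT⟩ := hP β hβ
  refine ⟨T, fun t ht j hj v hv => ?_⟩
  have hc1 : ∀ a : ℝ, 0 ≤ a → min c 1 * a ≤ a := fun a ha =>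
    mul_le_of_le_one_left ha (min_le_right _ _)
  have hexp := Real.exp_pos (-β * t)
  rcases le_or_gt j n with hjn | hjn
  · rcases le_max_iff.1 (hT t ht j hj hjn _ ⟨v, hv, fun _ => rfl⟩) with h | h
    · rcases isEmpty_or_nonempty {I : Finset (Fin (n + 1)) // 0 ∈ I ∧ I.card = j} with hE | hE
      · rw [maxNormP, Real.iSup_of_isEmpty, mul_zero] at h
        exact absurd h (not_le.2 hexp)
      obtain ⟨⟨I, h0, hI⟩, hmax⟩ := exists_eq_ciSup_of_finite
        (f := fun I : {I : Finset (Fin (n + 1)) // 0 ∈ I ∧ I.card = j} =>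
          ‖P.mulVec (cIw (fun I => (minorDet v I : ℝ)) I.1)‖)
      rw [maxNormP, ← hmax] at h
      obtain ⟨y, hy, hle⟩ := hcg (P.mulVec (cIw (fun I => (minorDet v I : ℝ)) I))
      refine ⟨y, hy, le_trans ?_ (abs_det_submatrix_le_maxMinor _ (I.orderEmbOfFin hI))⟩
      rw [det_mul_flowMatrix_of_mem hn (intRows v) t _ (fun I => (minorDet v I : ℝ))
        (fun I hI => minorDet_eq_det v I hI) I hI h0,
        dotProduct_eq_of_eq_vecMul (hfP y (hz hy)), abs_mul, abs_of_pos (Real.exp_pos _)]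
      calc min c 1 * Real.exp (-β * t) ≤ c * Real.exp (-β * t) :=
            mul_le_mul_of_nonneg_right (min_le_left _ _) hexp.le
        _ ≤ c * _ := mul_le_mul_of_nonneg_left h hc.le
        _ = Real.exp (((n : ℝ) + 1 - j) / n * t) *
            (c * ‖P.mulVec (cIw (fun I => (minorDet v I : ℝ)) I)‖) := by ring
        _ ≤ _ := mul_le_mul_of_nonneg_left hle (Real.exp_pos _).le
    · rcases isEmpty_or_nonempty {I : Finset (Fin (n + 1)) // 0 ∉ I ∧ I.card = j} with hE | hE
      · rw [maxCoeff, Real.iSup_of_isEmpty, mul_zero] at h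
        exact absurd h (not_le.2 hexp)
      obtain ⟨⟨I, h0, hI⟩, hmax⟩ := exists_eq_ciSup_of_finite
        (f := fun I : {I : Finset (Fin (n + 1)) // 0 ∉ I ∧ I.card = j} =>
          |((minorDet v I.1 : ℤ) : ℝ)|)
      rw [maxCoeff, ← hmax] at h
      refine ⟨z, Metric.mem_ball_self hr,
        le_trans ?_ (abs_det_submatrix_le_maxMinor _ (I.orderEmbOfFin hI))⟩
      rw [det_mul_flowMatrix_of_notMem _ _ _ I hI h0, abs_mul, abs_of_pos (Real.exp_pos _),
        ← minorDet_eq_det v I hI]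
      exact (hc1 _ hexp.le).trans h
  · obtain rfl : j = n + 1 := by
      have := (linearIndependent_row_intRows hv).fintype_card_le_finrank
      simp only [Fintype.card_fin, Module.finrank_fin_fun] at this
      omega
    refine ⟨z, Metric.mem_ball_self hr, le_trans ?_ (abs_det_submatrix_le_maxMinor _ id)⟩
    rw [Matrix.submatrix_id_id, Matrix.det_mul,
      det_flowMatrix hn t _ (Fin.cons_zero (α := fun _ => ℝ) _ _), mul_one]
    have h1 : (intRows v).det = ((Matrix.of v).det : ℝ) := by
      rw [← eq_intCast (Int.castRingHom ℝ), RingHom.map_det]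
      rfl
    have h2 : (intRows v).det ≠ 0 := by
      have := linearIndependent_row_intRows hv
      rw [Matrix.linearIndependent_rows_iff_isUnit, Matrix.isUnit_iff_isUnit_det] at this
      exact this.ne_zero
    have h3 : (1 : ℝ) ≤ |(intRows v).det| := by
      rw [h1] at h2 ⊢
      exact_mod_cast Int.one_le_abs (by exact_mod_cast h2)
    refine ((hc1 _ hexp.le).trans ?_).trans h3
    rw [Real.exp_le_one_iff]
    nlinarith

/-- Finite-time estimate: points of a small ball whose lattice has a vector shorter than
`exp (-γ t)` occupy an exponentially small proportion. -/
theorem volume_exists_short_le {d s n : ℕ} (hn : n ≠ 0) {g : (Fin d → ℝ) → Fin s → ℝ}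
    {P : Matrix (Fin (s + 1)) (Fin (n + 1)) ℝ} {f : (Fin d → ℝ) → Fin n → ℝ}
    {V : Set (Fin d → ℝ)} (hVo : IsOpen V) {M : ℝ} (hM : ∀ x ∈ V, ∀ i, |g x i| ≤ M)
    (hf : ContinuousOn f V)
    (hfP : ∀ x ∈ V, Fin.cons 1 (f x) = Matrix.vecMul (Fin.cons 1 (g x)) P) {C α : ℝ}
    (hgood : ∀ (c₀ : ℝ) (c : Fin s → ℝ), IsGoodOn C α (fun x => c₀ + ∑ i, c i * g x i) V)
    {x₀ : Fin d → ℝ} {r₀ : ℝ} (hr₀ : 0 < r₀) (hV : Metric.ball x₀ (8 ^ (n + 1) * r₀) ⊆ V)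
    (t : ℝ) {ε ρ : ℝ} (hε : 0 < ε) (hερ : ε ≤ ρ) (hρ1 : ρ ≤ 1)
    (hsup : ∀ j : ℕ, 1 ≤ j → ∀ v : Fin j → Fin (n + 1) → ℤ, LinearIndependent ℤ v →
      ∃ y ∈ Metric.ball x₀ r₀,
        ρ ≤ maxMinor (intRows v * flowMatrix n t (Fin.cons 1 (f y)))) :
    volume {x ∈ Metric.ball x₀ r₀ | ∃ u : Fin (n + 1) → ℤ, u ≠ 0 ∧
        (n + 1) * ‖(fun a => (u a : ℝ)) ᵥ* flowMatrix n t (Fin.cons 1 (f x))‖ < ε} ≤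
      flagConst d (n + 1) * ENNReal.ofReal (C * (ε / ρ) ^ α) * volume (Metric.ball x₀ r₀) := by
  have hρ : 0 < ρ := hε.trans_le hερ
  refine (measure_mono ?_).trans (volume_not_isMarked_le
    (S := RatSubspace (n + 1)) (fun W => Module.finrank ℝ W.1)
    (fun a b hab h => Subtype.ext (Submodule.eq_of_le_of_finrank_eq hab h))
    (fun W x => W.covol (flowMatrix n t (Fin.cons 1 (f x)))) V ε ρ
    (ENNReal.ofReal (C * (ε / ρ) ^ α)) (n + 1) (Finset.Icc 1 (n + 1)) (by simp) Set.univ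
    ?_ ?_ ?_ x₀ r₀ hr₀ hV ?_)
  · rintro x ⟨hx, u, hu, hlt⟩
    refine ⟨hx, ?_⟩
    rintro ⟨F, -, hF, hchain, h₁, h₂⟩
    have := le_norm_vecMul_of_flag (flowMatrix n t (Fin.cons 1 (f x))) hερ hρ1 hF hchain h₁
      (fun a ha => h₂ a (Set.mem_univ a) ha) hu
    exact absurd hlt (not_lt.2 this)
  · intro W _
    obtain ⟨W, j, hj, v, hv, rfl⟩ := W
    have := (linearIndependent_row_intRows hv).fintype_card_le_finrank
    simp only [Fintype.card_fin, Module.finrank_fin_fun] at this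
    simp only [finrank_intSpan hv, Finset.mem_Icc]
    exact ⟨hj, this⟩
  · intro W _ x hx hlt
    obtain ⟨j, hj, v, hv, -, hcov⟩ := W.exists_covol_eq
    simp only [hcov] at hlt ⊢
    exact ((continuous_maxMinor_mul_flowMatrix (intRows v) t).continuousAt.comp
      (hf.continuousAt (hVo.mem_nhds hx))).eventually_lt_const hlt
  · intro W _ z r hr hz hy
    obtain ⟨j, hj, v, hv, -, hcov⟩ := W.exists_covol_eq
    simp only [hcov] at hy ⊢
    exact volume_maxMinor_lt_le hn hM hfP hgood v t hε hρ hr hz hy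
  · intro W _
    obtain ⟨j, hj, v, hv, -, hcov⟩ := W.exists_covol_eq
    obtain ⟨y, hy, hle⟩ := hsup j hj v hv
    refine ⟨y, Metric.ball_subset_ball (by linarith) hy, ?_⟩
    simpa only [hcov] using hle

theorem volume_frequently_short_eq_zero {d s n : ℕ} (hn : n ≠ 0) {U : Set (Fin d → ℝ)}
    {g : (Fin d → ℝ) → Fin s → ℝ}
    (hindep : ∀ x ∈ U, ∀ (c₀ : ℝ) (c : Fin s → ℝ),
      (∀ᶠ y in nhds x, c₀ + ∑ i, c i * g y i = 0) → c₀ = 0 ∧ c = 0)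
    {P : Matrix (Fin (s + 1)) (Fin (n + 1)) ℝ} {f : (Fin d → ℝ) → Fin n → ℝ}
    (hfP : ∀ x ∈ U, Fin.cons 1 (f x) = Matrix.vecMul (Fin.cons 1 (g x)) P)
    (hP : Cond36 P) {V : Set (Fin d → ℝ)} (hVU : V ⊆ U) (hVo : IsOpen V) {M : ℝ}
    (hM : ∀ x ∈ V, ∀ i, |g x i| ≤ M) (hf : ContinuousOn f V) {C α : ℝ} (hα : 0 < α)
    (hgood : ∀ (c₀ : ℝ) (c : Fin s → ℝ), IsGoodOn C α (fun x => c₀ + ∑ i, c i * g x i) V)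
    {x₀ : Fin d → ℝ} {r₀ : ℝ} (hr₀ : 0 < r₀) (hV : Metric.ball x₀ (8 ^ (n + 1) * r₀) ⊆ V)
    {γ : ℝ} (hγ : 0 < γ) :
    volume {x | ∃ᶠ t : ℕ in Filter.atTop, x ∈ Metric.ball x₀ r₀ ∧ ∃ u : Fin (n + 1) → ℤ, u ≠ 0 ∧
      ‖(fun a => (u a : ℝ)) ᵥ* flowMatrix n t (Fin.cons 1 (f x))‖ ≤ Real.exp (-γ * t)} = 0 := by
  have hball : Metric.ball x₀ r₀ ⊆ V := (Metric.ball_subset_ball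
    (le_mul_of_one_le_left hr₀.le (one_le_pow₀ (by norm_num)))).trans hV
  obtain ⟨c, hc, hc1, hcond⟩ := exists_le_maxMinor_of_cond36 hn hindep hfP hP hr₀
    (hball.trans hVU)
  obtain ⟨T, hT⟩ := hcond (γ / 2) (half_pos hγ)
  set D : ℝ := 2 * (n + 1) / c with hD
  have hD0 : 0 < D := by positivity
  have hlim : Filter.Tendsto (fun t : ℕ => D * Real.exp (-(γ / 2) * t))
      Filter.atTop (nhds (D * 0)) :=
    ((Real.tendsto_exp_atBot.comp (Filter.tendsto_id.const_mul_atTop_of_neg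
      (by linarith : -(γ / 2) < 0))).comp tendsto_natCast_atTop_atTop).const_mul _
  rw [mul_zero] at hlim
  obtain ⟨N, hN⟩ := Filter.eventually_atTop.1 ((hlim.eventually_lt_const one_pos).and
    ((tendsto_natCast_atTop_atTop (R := ℝ)).eventually_ge_atTop T))
  set B : ℕ → Set (Fin d → ℝ) := fun t => {x | x ∈ Metric.ball x₀ r₀ ∧
    ∃ u : Fin (n + 1) → ℤ, u ≠ 0 ∧
      ‖(fun a => (u a : ℝ)) ᵥ* flowMatrix n t (Fin.cons 1 (f x))‖ ≤ Real.exp (-γ * t)} with hB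
  set q : ℝ := Real.exp (-(γ / 2) * α) with hq
  have hq1 : q < 1 := Real.exp_lt_one_iff.2 (by nlinarith)
  have hbound : ∀ t : ℕ, N ≤ t → volume (B t) ≤
      flagConst d (n + 1) * volume (Metric.ball x₀ r₀) * ENNReal.ofReal (C * D ^ α * q ^ t) := by
    intro t ht
    obtain ⟨ht1, ht2⟩ := hN t ht
    set ε : ℝ := 2 * (n + 1) * Real.exp (-γ * t) with hε
    set ρ : ℝ := c * Real.exp (-(γ / 2) * t) with hρ
    have hε0 : 0 < ε := by positivity
    have hρ0 : 0 < ρ := by positivity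
    have hsplit : Real.exp (-γ * t) = Real.exp (-(γ / 2) * t) * Real.exp (-(γ / 2) * t) := by
      rw [← Real.exp_add]; congr 1; ring
    have hratio : ε / ρ = D * Real.exp (-(γ / 2) * t) := by
      rw [hε, hρ, hD, hsplit]
      field_simp
    have hερ : ε ≤ ρ := by
      rw [← div_le_one hρ0, hratio]
      exact ht1.le
    have hρ1 : ρ ≤ 1 := by
      have : Real.exp (-(γ / 2) * t) ≤ 1 := by
        rw [Real.exp_le_one_iff]
        have : (0 : ℝ) ≤ t := t.cast_nonneg
        nlinarith
      exact mul_le_one₀ hc1 (Real.exp_pos _).le this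
    have hmain := volume_exists_short_le hn hVo hM hf (fun x hx => hfP x (hVU hx)) hgood hr₀ hV
      (t : ℝ) hε0 hερ hρ1 (fun j hj v hv => hT t ht2 j hj v hv)
    have hpow : C * (ε / ρ) ^ α = C * D ^ α * q ^ t := by
      rw [hratio, Real.mul_rpow hD0.le (Real.exp_pos _).le, ← Real.exp_mul, hq,
        ← Real.exp_nat_mul, ← mul_assoc]
      congr 2
      ring
    rw [hpow] at hmain
    refine (measure_mono ?_).trans (hmain.trans (mul_right_comm _ _ _).le)
    rintro x ⟨hx, u, hu, hle⟩
    refine ⟨hx, u, hu, ?_⟩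
    have h1 : (0 : ℝ) < n + 1 := by positivity
    have h2 := mul_le_mul_of_nonneg_left hle h1.le
    have h3 : 0 < (n + 1) * Real.exp (-γ * t) := by positivity
    rw [hε]
    linarith
  have hfin : ∑' t : ℕ, volume {x | x ∈ B (t + N)} ≠ ⊤ := by
    have hle : ∑' t : ℕ, volume {x | x ∈ B (t + N)} ≤
        ∑' t : ℕ, flagConst d (n + 1) * volume (Metric.ball x₀ r₀) *
          ENNReal.ofReal (C * D ^ α * q ^ (t + N)) :=
      ENNReal.tsum_le_tsum fun t => hbound (t + N) (Nat.le_add_left _ _)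
    refine ne_top_of_le_ne_top ?_ hle
    rw [ENNReal.tsum_mul_left]
    refine ENNReal.mul_ne_top (ENNReal.mul_ne_top (flagConst_ne_top _ _)
      measure_ball_lt_top.ne) (Summable.tsum_ofReal_ne_top ?_)
    simp only [pow_add]
    exact ((summable_geometric_of_lt_one (Real.exp_pos _).le hq1).mul_right _).mul_left _
  have hzero := measure_setOfPred_frequently_eq_zero hfin
  refine measure_mono_null ?_ hzero
  intro x hx
  refine Filter.frequently_atTop.2 fun a => ?_
  obtain ⟨t, ht, hxt⟩ := Filter.frequently_atTop.1 hx (a + N)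
  refine ⟨t - N, by omega, ?_⟩
  rw [Nat.sub_add_cancel (by omega)]
  exact hxt

theorem isExtremal_of_cond36 {d s n : ℕ} (hn : n ≠ 0) {U : Set (Fin d → ℝ)}
    {g : (Fin d → ℝ) → Fin s → ℝ} (hcont : ContinuousOn g U)
    (hgood : volume {x ∈ U | ¬ GoodAt U g x} = 0)
    (hindep : ∀ x ∈ U, ∀ (c₀ : ℝ) (c : Fin s → ℝ),
      (∀ᶠ y in nhds x, c₀ + ∑ i, c i * g y i = 0) → c₀ = 0 ∧ c = 0)
    {P : Matrix (Fin (s + 1)) (Fin (n + 1)) ℝ} {f : (Fin d → ℝ) → Fin n → ℝ}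
    (hfP : ∀ x ∈ U, Fin.cons 1 (f x) = Matrix.vecMul (Fin.cons 1 (g x)) P)
    (hP : Cond36 P) : IsExtremal U f := by
  have hsub : {x ∈ U | IsVWA (f x)} ⊆
      {x ∈ U | ¬ GoodAt U g x} ∪ {x ∈ U | GoodAt U g x ∧ IsVWA (f x)} := by
    rintro x ⟨hx, hv⟩
    by_cases hg : GoodAt U g x
    · exact Or.inr ⟨hx, hg, hv⟩
    · exact Or.inl ⟨hx, hg⟩
  refine measure_mono_null hsub (measure_union_null hgood
    (measure_null_of_locally_null _ fun x₀ hx₀ => ?_))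
  obtain ⟨hx₀U, ⟨V, hVn, hVU, C, -, α, hα, hgoodV⟩, -⟩ := hx₀
  obtain ⟨R, hR, hRV⟩ := Metric.nhds_basis_closedBall.mem_iff.1 hVn
  have hballV : Metric.ball x₀ R ⊆ V := Metric.ball_subset_closedBall.trans hRV
  obtain ⟨M, hM⟩ := (isCompact_closedBall x₀ R).exists_bound_of_continuousOn
    (hcont.mono (hRV.trans hVU))
  set r₀ := R / 8 ^ (n + 1) with hr₀def
  have hr₀ : 0 < r₀ := by positivity
  have hr₀R : 8 ^ (n + 1) * r₀ = R := by rw [hr₀def]; field_simp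
  have hnull := fun m : ℕ => volume_frequently_short_eq_zero hn hindep hfP hP
    (V := Metric.ball x₀ R) (hballV.trans hVU) Metric.isOpen_ball
    (fun x hx i => (norm_le_pi_norm (g x) i).trans (hM x (Metric.ball_subset_closedBall hx)))
    ((continuousOn_of_cons_eq_vecMul hcont hfP).mono (hballV.trans hVU)) hα
    (fun c₀ c z ρ hρ hz => hgoodV c₀ c z ρ hρ (hz.trans hballV)) hr₀
    (Metric.ball_subset_ball hr₀R.le) (γ := 1 / ((m : ℝ) + 1)) (by positivity)
  refine ⟨Metric.ball x₀ r₀ ∩ {x ∈ U | GoodAt U g x ∧ IsVWA (f x)},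
    Filter.inter_mem (mem_nhdsWithin_of_mem_nhds (Metric.ball_mem_nhds x₀ hr₀))
      self_mem_nhdsWithin, measure_mono_null ?_ (measure_iUnion_null hnull)⟩
  rintro x ⟨hx, -, -, hv⟩
  obtain ⟨γ, hγ, hshort⟩ := hv.exists_exponentially_short hn
  obtain ⟨m, hm⟩ := exists_nat_one_div_lt hγ
  refine Set.mem_iUnion.2 ⟨m, Filter.frequently_atTop.2 fun N => ?_⟩
  obtain ⟨t, ht, u, hu, hle⟩ := hshort N
  refine ⟨t, ht, hx, u, hu, hle.trans (Real.exp_le_exp.2 ?_)⟩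
  have : (0 : ℝ) ≤ t := t.cast_nonneg
  nlinarith

theorem not_isVWA_of_isEmpty {n : ℕ} (hn : n = 0) (y : Fin n → ℝ) : ¬ IsVWA y := by
  subst hn
  rintro ⟨v, -, hv⟩
  exact hv (Set.toFinite _)

theorem cond36_of_eq_zero {s n : ℕ} (hn : n = 0) (P : Matrix (Fin (s + 1)) (Fin (n + 1)) ℝ) :
    Cond36 P :=
  fun _ _ => ⟨1, one_pos, fun _ _ j hj hjn => absurd (hj.trans hjn) (by omega)⟩

theorem nonempty_of_isExtremal {d n : ℕ} {U : Set (Fin d → ℝ)} (hU : IsOpen U) (hUne : U.Nonempty)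
    {f : (Fin d → ℝ) → Fin n → ℝ} (h : IsExtremal U f) : {x ∈ U | ¬ IsVWA (f x)}.Nonempty := by
  by_contra hne
  rw [Set.not_nonempty_iff_eq_empty, Set.eq_empty_iff_forall_notMem] at hne
  have hsub : U ⊆ {x ∈ U | IsVWA (f x)} := fun x hx => ⟨hx, by_contra fun hv => hne x ⟨hx, hv⟩⟩
  exact (hU.measure_pos volume hUne).ne' (measure_mono_null hsub h)

/-- **Theorem 4.1.** Let `U ⊆ ℝ^d` be open and nonempty, and `g = (g₁,…,g_s) : U → ℝ^s` a
continuous good map such that at every `x ∈ U` the germs of `1, g₁, …, g_s` are linearly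
independent over `ℝ`. Fix `P ∈ M_{s+1,n+1}(ℝ)` and let `f : U → ℝ^n` be given by
`(1, f(x)) = (1, g(x)) P`. Then condition (3.6) for `P`, the nonemptiness of
`{x ∈ U : f(x) is not VWA}`, and the extremality of `f` are all equivalent. -/
theorem extremality_criterion_for_P (d s n : ℕ) (U : Set (Fin d → ℝ)) (hU : IsOpen U)
    (hUne : U.Nonempty) (g : (Fin d → ℝ) → Fin s → ℝ) (hcont : ContinuousOn g U)
    (hgood : volume {x ∈ U | ¬ GoodAt U g x} = 0)
    (hindep : ∀ x ∈ U, ∀ (c₀ : ℝ) (c : Fin s → ℝ),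
      (∀ᶠ y in nhds x, c₀ + ∑ i, c i * g y i = 0) → c₀ = 0 ∧ c = 0)
    (P : Matrix (Fin (s + 1)) (Fin (n + 1)) ℝ)
    (f : (Fin d → ℝ) → Fin n → ℝ)
    (hfP : ∀ x ∈ U, Fin.cons 1 (f x) = Matrix.vecMul (Fin.cons 1 (g x)) P) :
    (Cond36 P ↔ {x ∈ U | ¬ IsVWA (f x)}.Nonempty) ∧
    ({x ∈ U | ¬ IsVWA (f x)}.Nonempty ↔ IsExtremal U f) := by
  have h31 : Cond36 P → IsExtremal U f := fun hP => by
    rcases eq_or_ne n 0 with hn | hn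
    · have : {x ∈ U | IsVWA (f x)} = ∅ := by
        ext x
        simp [not_isVWA_of_isEmpty hn]
      rw [IsExtremal, this, measure_empty]
    · exact isExtremal_of_cond36 hn hcont hgood hindep hfP hP
  have h12 : {x ∈ U | ¬ IsVWA (f x)}.Nonempty → Cond36 P := by
    rintro ⟨x, hx, hnv⟩
    rcases eq_or_ne n 0 with hn | hn
    · exact cond36_of_eq_zero hn P
    · by_contra hP
      exact hnv (isVWA_of_not_cond36 hn hP (hfP x hx))
  have h23 := nonempty_of_isExtremal (f := f) hU hUne
  exact ⟨⟨fun h => h23 (h31 h), h12⟩, ⟨fun h => h31 (h12 h), h23⟩⟩
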